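/- arXiv:1205.5458 — 3 statements merged into one kernel-verified Lean document; each statement's English description precedes it below -/
import Mathlib

section
/- Let σ be a smooth function on ℝⁿ \ {0} that is homogeneous of degree d, i.e. σ(λη) = λ^d σ(η) for all λ > 0 and η ≠ 0. If d is not of the form -n - k for a natural number k, then σ extends to a distribution τ on ℝⁿ that is homogeneous of degree d (meaning τ(φ_λ) = λ^{-d} τ(φ) for φ_λ(η) := λ^n φ(λη)). -/
open MeasureTheory Set Filter Topology Module

lemma exists_pos_forall_norm_lt_eq_zero {E F : Type*} [SeminormedAddCommGroup E] [Zero F]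
    {f : E → F} (hf : (0 : E) ∉ tsupport f) :
    ∃ ε : ℝ, 0 < ε ∧ ∀ x : E, ‖x‖ < ε → f x = 0 := by
  obtain ⟨ε, hε, h⟩ := Metric.eventually_nhds_iff.mp (notMem_tsupport_iff_eventuallyEq.mp hf)
  exact ⟨ε, hε, fun x hx => h (by simpa using hx)⟩

section Homogeneous

variable {E : Type*} [NormedAddCommGroup E] [NormedSpace ℝ E]

/-- A positively homogeneous function of degree `d` that is continuous away from the origin is
bounded there by a multiple of `‖x‖ ^ d`. -/
lemma exists_abs_le_mul_norm_rpow_of_homogeneous [FiniteDimensional ℝ E] {d : ℝ} {σ : E → ℝ}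
    (hσ : ContinuousOn σ {0}ᶜ)
    (hhom : ∀ l : ℝ, 0 < l → ∀ x : E, x ≠ 0 → σ (l • x) = l ^ d * σ x) :
    ∃ C : ℝ, 0 ≤ C ∧ ∀ x : E, x ≠ 0 → |σ x| ≤ C * ‖x‖ ^ d := by
  have : ProperSpace E := FiniteDimensional.proper ℝ E
  obtain ⟨C, hC⟩ := (isCompact_sphere (0 : E) 1).exists_bound_of_continuousOn
    (hσ.mono fun x hx => by
      rintro rfl
      simp at hx)
  refine ⟨max C 0, le_max_right _ _, fun x hx => ?_⟩
  have hx' : 0 < ‖x‖ := norm_pos_iff.mpr hx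
  have h := hhom ‖x‖ hx' (‖x‖⁻¹ • x) (smul_ne_zero (inv_ne_zero hx'.ne') hx)
  rw [smul_inv_smul₀ hx'.ne'] at h
  have hs := hC (‖x‖⁻¹ • x) (by simp [norm_smul, hx'.ne'])
  rw [h, abs_mul, abs_of_nonneg (by positivity), mul_comm]
  gcongr
  exact hs.trans (le_max_left _ _)

/-- Change of variables for the pairing with a homogeneous function. -/
lemma integral_homogeneous_mul_comp_smul [FiniteDimensional ℝ E] [Nontrivial E]
    [MeasurableSpace E] [BorelSpace E] (μ : Measure E) [μ.IsAddHaarMeasure] {d : ℝ} {σ : E → ℝ}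
    (hhom : ∀ l : ℝ, 0 < l → ∀ x : E, x ≠ 0 → σ (l • x) = l ^ d * σ x)
    (φ : E → ℝ) {l : ℝ} (hl : 0 < l) :
    ∫ x, σ x * φ (l • x) ∂μ = l ^ (-(finrank ℝ E : ℝ) - d) * ∫ x, σ x * φ x ∂μ := by
  have hae : ∀ᵐ x ∂μ, x ≠ 0 := Measure.ae_ne μ 0
  calc ∫ x, σ x * φ (l • x) ∂μ
      = ∫ x, l ^ (-d) * (fun y => σ y * φ y) (l • x) ∂μ := by
        refine integral_congr_ae (hae.mono fun x hx => ?_)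
        simp only
        rw [hhom l hl x hx, ← mul_assoc, ← mul_assoc, ← Real.rpow_add hl]
        simp
    _ = l ^ (-(finrank ℝ E : ℝ) - d) * ∫ x, σ x * φ x ∂μ := by
        rw [integral_const_mul,
          Measure.integral_comp_smul_of_nonneg μ (fun y => σ y * φ y) l (hR := hl.le),
          smul_eq_mul, ← mul_assoc, sub_eq_add_neg, Real.rpow_add hl,
          Real.rpow_neg hl.le (finrank ℝ E : ℝ), Real.rpow_natCast, mul_comm (l ^ (-d))]

/-- Schwartz functions decay faster than any power of `1 + ‖x‖`, with explicit constants. -/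
lemma SchwartzMap.norm_le_sup_seminorm_mul_one_add_norm_rpow {F : Type*} [NormedAddCommGroup F]
    [NormedSpace ℝ F] (φ : SchwartzMap E F) (N : ℕ) (x : E) :
    ‖φ x‖ ≤ 2 ^ N * (Finset.Iic (N, 0)).sup (schwartzSeminormFamily ℝ E F) φ *
      (1 + ‖x‖) ^ (-(N : ℝ)) := by
  have h := SchwartzMap.one_add_le_sup_seminorm_apply (𝕜 := ℝ) (m := (N, 0)) (k := N) (n := 0)
    le_rfl le_rfl φ x
  rw [norm_iteratedFDeriv_zero] at h
  rw [Real.rpow_neg (by positivity), Real.rpow_natCast, ← div_eq_mul_inv,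
    le_div_iff₀ (by positivity), mul_comm]
  exact h

/-- Schwartz functions decay faster than any power of `1 + ‖x‖`. -/
lemma SchwartzMap.exists_norm_le_mul_one_add_norm_rpow {F : Type*} [NormedAddCommGroup F]
    [NormedSpace ℝ F] (φ : SchwartzMap E F) (N : ℕ) :
    ∃ K : ℝ, 0 ≤ K ∧ ∀ x : E, ‖φ x‖ ≤ K * (1 + ‖x‖) ^ (-(N : ℝ)) :=
  ⟨_, by positivity, φ.norm_le_sup_seminorm_mul_one_add_norm_rpow N⟩

variable [FiniteDimensional ℝ E] [MeasurableSpace E] [BorelSpace E] (μ : Measure E)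
  [μ.IsAddHaarMeasure]

lemma integrableOn_norm_rpow_mul_one_add_norm_rpow {d r ε : ℝ} (hε : 0 < ε)
    (hr : finrank ℝ E + d < r) (hr0 : 0 ≤ r) :
    IntegrableOn (fun x : E => ‖x‖ ^ d * (1 + ‖x‖) ^ (-r)) {x | ε ≤ ‖x‖} μ := by
  have hint := ((integrable_one_add_norm (E := E) (μ := μ) (r := r - d)
    (by linarith)).const_mul ((ε⁻¹ + 1) ^ (r - d))).integrableOn (s := {x | ε ≤ ‖x‖})
  refine hint.mono' (by fun_prop : Measurable _).aestronglyMeasurable ?_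
  refine (ae_restrict_iff' (measurableSet_le measurable_const measurable_norm)).mpr
    (Eventually.of_forall fun x (hx : ε ≤ ‖x‖) => ?_)
  have hx0 : 0 < ‖x‖ := hε.trans_le hx
  have hrd : 0 ≤ r - d := by
    have : (0 : ℝ) ≤ finrank ℝ E := by positivity
    linarith
  rw [Real.norm_of_nonneg (by positivity)]
  calc ‖x‖ ^ d * (1 + ‖x‖) ^ (-r) ≤ ‖x‖ ^ d * ‖x‖ ^ (-r) := by
        gcongr ?_ * ?_
        exact Real.rpow_le_rpow_of_nonpos hx0 (by linarith) (by linarith)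
    _ = (‖x‖ ^ (r - d))⁻¹ := by
        rw [← Real.rpow_add hx0, ← Real.rpow_neg hx0.le]
        congr 1
        ring
    _ ≤ (ε⁻¹ + 1) ^ (r - d) * (1 + ‖x‖) ^ (-(r - d)) := by
        rw [Real.rpow_neg (by positivity), ← div_eq_mul_inv, le_div_iff₀ (by positivity),
          inv_mul_le_iff₀ (by positivity), ← Real.mul_rpow (by positivity) (by positivity)]
        refine Real.rpow_le_rpow (by positivity) ?_ hrd
        have : 1 ≤ ‖x‖ * ε⁻¹ := by
          rw [← div_eq_mul_inv, one_le_div hε]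
          exact hx
        linarith

lemma integrable_norm_rpow_mul_one_add_norm_rpow [Nontrivial E] {d r : ℝ}
    (hd : -(finrank ℝ E : ℝ) < d) (hr : finrank ℝ E + d < r) :
    Integrable (fun x : E => ‖x‖ ^ d * (1 + ‖x‖) ^ (-r)) μ := by
  have hball : IntegrableOn (fun x : E => ‖x‖ ^ d) {x | ‖x‖ < 1} μ := by
    have hmeas : MeasurableSet {x : E | ‖x‖ < 1} :=
      measurableSet_lt measurable_norm measurable_const
    rw [← integrable_indicator_iff hmeas]
    have h : IntegrableOn (fun y : ℝ => y ^ (finrank ℝ E - 1) • (Iio (1 : ℝ)).indicator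
        (fun y => y ^ d) y) (Ioi 0) := by
      have hI : IntegrableOn (fun y : ℝ => y ^ ((finrank ℝ E : ℝ) - 1 + d)) (Ioo 0 1) :=
        (intervalIntegral.integrableOn_Ioo_rpow_iff one_pos).mpr (by linarith)
      rw [← integrable_indicator_iff measurableSet_Ioo] at hI
      rw [← integrable_indicator_iff measurableSet_Ioi]
      refine hI.congr (Eventually.of_forall fun y => ?_)
      have hpos : 1 ≤ finrank ℝ E := finrank_pos
      by_cases h0 : 0 < y
      · by_cases h1 : y < 1
        · simp only [indicator, mem_Ioo, mem_Ioi, mem_Iio, h0, h1, and_self, if_true, smul_eq_mul]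
          rw [Real.rpow_add h0, ← Real.rpow_natCast y, Nat.cast_sub hpos, Nat.cast_one]
        · simp [indicator, h0, h1]
      · simp [indicator, h0]
    exact (integrable_fun_norm_addHaar μ).mpr h
  have h2 := integrableOn_norm_rpow_mul_one_add_norm_rpow μ one_pos hr (by linarith)
  have h1 : IntegrableOn (fun x : E => ‖x‖ ^ d * (1 + ‖x‖) ^ (-r)) {x | ‖x‖ < 1} μ := by
    refine hball.mono' (by fun_prop : Measurable _).aestronglyMeasurable
      (Eventually.of_forall fun x => ?_)
    rw [Real.norm_of_nonneg (by positivity)]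
    exact mul_le_of_le_one_right (by positivity)
      (Real.rpow_le_one_of_one_le_of_nonpos (by simp) (by linarith))
  rw [← integrableOn_univ]
  refine (h1.union h2).mono_set fun x _ => ?_
  exact lt_or_ge ‖x‖ 1

/-- Away from the origin, `‖x‖ ^ d` is integrable against a suitable power of `1 + ‖x‖`. -/
lemma integrable_indicator_norm_rpow_mul {d ε : ℝ} (hε : 0 < ε) :
    ∃ N : ℕ, Integrable ({x : E | ε ≤ ‖x‖}.indicator
      fun x => ‖x‖ ^ d * (1 + ‖x‖) ^ (-(N : ℝ))) μ := by
  obtain ⟨N, hN⟩ := exists_nat_gt (finrank ℝ E + d)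
  exact ⟨N, (integrable_indicator_iff (measurableSet_le measurable_const measurable_norm)).mpr
    (integrableOn_norm_rpow_mul_one_add_norm_rpow μ hε hN N.cast_nonneg)⟩

variable {d : ℝ} {σ : E → ℝ}

lemma integrable_homogeneous_mul_of_zero_notMem_tsupport (hσ : ContinuousOn σ {0}ᶜ)
    (hhom : ∀ l : ℝ, 0 < l → ∀ x : E, x ≠ 0 → σ (l • x) = l ^ d * σ x)
    (φ : SchwartzMap E ℝ) (hφ : (0 : E) ∉ tsupport φ) :
    Integrable (fun x => σ x * φ x) μ := by
  obtain ⟨C, hC, hσC⟩ := exists_abs_le_mul_norm_rpow_of_homogeneous hσ hhom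
  obtain ⟨ε, hε, hφ0⟩ := exists_pos_forall_norm_lt_eq_zero hφ
  obtain ⟨N, hN⟩ := integrable_indicator_norm_rpow_mul μ (d := d) hε
  obtain ⟨K, hK, hφK⟩ := φ.exists_norm_le_mul_one_add_norm_rpow N
  refine (hN.const_mul (C * K)).mono'
    ((measurable_of_continuousOn_compl_singleton 0 hσ).mul
      φ.continuous.measurable).aestronglyMeasurable (Eventually.of_forall fun x => ?_)
  by_cases hx : ε ≤ ‖x‖
  · have hx0 : x ≠ 0 := norm_pos_iff.mp (hε.trans_le hx)
    simp only [indicator, mem_ofPred_eq, hx, if_true, norm_mul]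
    calc ‖σ x‖ * ‖φ x‖ ≤ (C * ‖x‖ ^ d) * (K * (1 + ‖x‖) ^ (-(N : ℝ))) := by
          gcongr
          exacts [hσC x hx0, hφK x]
      _ = _ := by ring
  · simp [indicator, hx, hφ0 x (not_le.mp hx)]

/-- Euler's identity in integrated form: pairing a homogeneous function of degree `d` with the
radial derivative of a test function vanishing near the origin multiplies the pairing by
`-n - d`. -/
lemma integral_homogeneous_mul_fderiv_self [Nontrivial E] (hσ : ContinuousOn σ {0}ᶜ)
    (hhom : ∀ l : ℝ, 0 < l → ∀ x : E, x ≠ 0 → σ (l • x) = l ^ d * σ x)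
    (φ : SchwartzMap E ℝ) (hφ : (0 : E) ∉ tsupport φ) :
    ∫ x, σ x * fderiv ℝ φ x x ∂μ = (-(finrank ℝ E : ℝ) - d) * ∫ x, σ x * φ x ∂μ := by
  obtain ⟨C, hC, hσC⟩ := exists_abs_le_mul_norm_rpow_of_homogeneous hσ hhom
  obtain ⟨ε, hε, hφ0⟩ := exists_pos_forall_norm_lt_eq_zero
    (fun h => hφ (tsupport_fderiv_subset ℝ h))
  obtain ⟨N, hN⟩ := integrable_indicator_norm_rpow_mul μ (d := d + 1) (half_pos hε)
  obtain ⟨K, hK, hφK⟩ :=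
    (SchwartzMap.fderivCLM ℝ E ℝ φ).exists_norm_le_mul_one_add_norm_rpow N
  have hmσ : Measurable σ := measurable_of_continuousOn_compl_singleton 0 hσ
  have hball : Metric.ball (1 : ℝ) (1 / 2) ∈ 𝓝 (1 : ℝ) := Metric.ball_mem_nhds _ (by norm_num)
  have hcont : Continuous (fderiv ℝ φ) := (SchwartzMap.fderivCLM ℝ E ℝ φ).continuous
  have key := hasDerivAt_integral_of_dominated_loc_of_deriv_le (μ := μ) (x₀ := (1 : ℝ))
    (F := fun t x => σ x * φ (t • x)) (F' := fun t x => σ x * fderiv ℝ φ (t • x) x)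
    (bound := fun x => C * K * 2 ^ N * {x : E | ε / 2 ≤ ‖x‖}.indicator
      (fun x => ‖x‖ ^ (d + 1) * (1 + ‖x‖) ^ (-(N : ℝ))) x) hball
    (Eventually.of_forall fun t => (hmσ.mul
      (φ.continuous.comp (continuous_const_smul t)).measurable).aestronglyMeasurable)
    (by simpa using integrable_homogeneous_mul_of_zero_notMem_tsupport μ hσ hhom φ hφ)
    (hmσ.mul ((hcont.comp (continuous_const_smul (1 : ℝ))).clm_apply
      continuous_id).measurable).aestronglyMeasurable
    (Eventually.of_forall fun x t ht => ?_) (hN.const_mul _)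
    (Eventually.of_forall fun x t _ => ?_)
  · have hpow : HasDerivAt (fun t : ℝ => t ^ (-(finrank ℝ E : ℝ) - d) * ∫ x, σ x * φ x ∂μ)
        ((-(finrank ℝ E : ℝ) - d) * ∫ x, σ x * φ x ∂μ) 1 := by
      simpa using (Real.hasDerivAt_rpow_const (x := 1) (p := -(finrank ℝ E : ℝ) - d)
        (Or.inl one_ne_zero)).mul_const (∫ x, σ x * φ x ∂μ)
    have hEq : (fun t : ℝ => ∫ x, σ x * φ (t • x) ∂μ) =ᶠ[𝓝 1]
        fun t : ℝ => t ^ (-(finrank ℝ E : ℝ) - d) * ∫ x, σ x * φ x ∂μ :=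
      (lt_mem_nhds one_pos).mono fun t ht => integral_homogeneous_mul_comp_smul μ hhom φ ht
    simpa using key.2.unique (hpow.congr_of_eventuallyEq hEq)
  · rw [Metric.mem_ball, Real.dist_eq, abs_lt] at ht
    have ht0 : 0 < t := by linarith
    have hnorm : ‖t • x‖ = t * ‖x‖ := by rw [norm_smul, Real.norm_of_nonneg ht0.le]
    by_cases hx : ε / 2 ≤ ‖x‖
    · have hx' : 0 < ‖x‖ := (half_pos hε).trans_le hx
      have hdecay : ‖fderiv ℝ φ (t • x)‖ ≤ K * (2 ^ N * (1 + ‖x‖) ^ (-(N : ℝ))) := by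
        refine (hφK (t • x)).trans ?_
        gcongr
        rw [Real.rpow_neg (by positivity), Real.rpow_neg (by positivity), Real.rpow_natCast,
          Real.rpow_natCast, ← div_eq_mul_inv, inv_le_iff_one_le_mul₀ (by positivity),
          div_mul_eq_mul_div, one_le_div (by positivity), ← mul_pow, hnorm]
        gcongr
        nlinarith
      simp only [indicator, mem_ofPred_eq, hx, if_true, norm_mul]
      calc ‖σ x‖ * ‖fderiv ℝ φ (t • x) x‖
          ≤ (C * ‖x‖ ^ d) * ((K * (2 ^ N * (1 + ‖x‖) ^ (-(N : ℝ)))) * ‖x‖) := by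
            gcongr
            · exact hσC x (norm_pos_iff.mp hx')
            · exact (ContinuousLinearMap.le_opNorm _ _).trans (by gcongr)
        _ = _ := by
            rw [Real.rpow_add hx', Real.rpow_one]
            ring
    · have hlt : ‖t • x‖ < ε := by
        rw [hnorm]
        nlinarith [norm_nonneg x]
      simp [indicator, hx, hφ0 _ hlt]
  · have hinner : HasDerivAt (fun s : ℝ => s • x) x t := by
      simpa using (hasDerivAt_id t).smul_const x
    exact (φ.differentiableAt.hasFDerivAt.comp_hasDerivAt t hinner).const_mul (σ x)

/-- Integration against a locally integrable homogeneous function is a tempered distribution. -/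
lemma exists_clm_eq_integral_homogeneous_mul [Nontrivial E] (hσ : ContinuousOn σ {0}ᶜ)
    (hhom : ∀ l : ℝ, 0 < l → ∀ x : E, x ≠ 0 → σ (l • x) = l ^ d * σ x)
    (hd : -(finrank ℝ E : ℝ) < d) :
    ∃ τ : SchwartzMap E ℝ →L[ℝ] ℝ, ∀ φ, τ φ = ∫ x, σ x * φ x ∂μ := by
  obtain ⟨C, hC, hσC⟩ := exists_abs_le_mul_norm_rpow_of_homogeneous hσ hhom
  obtain ⟨N, hN⟩ := exists_nat_gt (finrank ℝ E + d)
  have hint := integrable_norm_rpow_mul_one_add_norm_rpow μ hd hN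
  have hae : ∀ᵐ x ∂μ, x ≠ 0 := Measure.ae_ne μ 0
  have hbound : ∀ (φ : SchwartzMap E ℝ) (K : ℝ),
      (∀ x : E, ‖φ x‖ ≤ K * (1 + ‖x‖) ^ (-(N : ℝ))) → ∀ᵐ x ∂μ,
      ‖σ x * φ x‖ ≤ C * K * (‖x‖ ^ d * (1 + ‖x‖) ^ (-(N : ℝ))) := by
    intro φ K hφK
    filter_upwards [hae] with x hx
    calc ‖σ x * φ x‖ = ‖σ x‖ * ‖φ x‖ := norm_mul _ _
      _ ≤ (C * ‖x‖ ^ d) * (K * (1 + ‖x‖) ^ (-(N : ℝ))) := by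
          gcongr
          exacts [hσC x hx, hφK x]
      _ = _ := by ring
  have hφint : ∀ φ : SchwartzMap E ℝ, Integrable (fun x => σ x * φ x) μ := by
    intro φ
    obtain ⟨K, -, hφK⟩ := φ.exists_norm_le_mul_one_add_norm_rpow N
    exact (hint.const_mul (C * K)).mono'
      ((measurable_of_continuousOn_compl_singleton 0 hσ).mul
        φ.continuous.measurable).aestronglyMeasurable (hbound φ K hφK)
  refine ⟨SchwartzMap.mkCLMtoNormedSpace (fun φ => ∫ x, σ x * φ x ∂μ) (fun φ ψ => ?_)
    (fun a φ => ?_) ⟨Finset.Iic (N, 0),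
      C * 2 ^ N * ∫ x, ‖x‖ ^ d * (1 + ‖x‖) ^ (-(N : ℝ)) ∂μ, ?_, fun φ => ?_⟩, fun φ => rfl⟩
  · rw [← integral_add (hφint φ) (hφint ψ)]
    simp [mul_add]
  · rw [RingHom.id_apply, smul_eq_mul, ← integral_const_mul]
    simp [mul_left_comm]
  · exact mul_nonneg (by positivity) (integral_nonneg fun x => by positivity)
  · have h := norm_integral_le_of_norm_le (hint.const_mul _) (hbound φ _
      (φ.norm_le_sup_seminorm_mul_one_add_norm_rpow N))
    refine h.trans (le_of_eq ?_)
    rw [integral_const_mul]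
    ring

end Homogeneous

open LineDeriv in
/-- The extension of homogeneous functions of degree `d > -n - m`, by induction on `m` using
Euler's identity `(n + d) σ = ∑ j, ∂ⱼ (xⱼ σ)`. -/
lemma exists_homogeneous_extension_of_neg_sub_lt {n : ℕ} [NeZero n] (m : ℕ) :
    ∀ (d : ℝ) (σ : (Fin n → ℝ) → ℝ), ContinuousOn σ {0}ᶜ →
    (∀ l : ℝ, 0 < l → ∀ η : Fin n → ℝ, η ≠ 0 → σ (l • η) = l ^ d * σ η) →
    (∀ k : ℕ, d ≠ -(n : ℝ) - (k : ℝ)) → -(n : ℝ) - m < d →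
    ∃ τ : SchwartzMap (Fin n → ℝ) ℝ →L[ℝ] ℝ,
      (∀ φ : SchwartzMap (Fin n → ℝ) ℝ, (0 : Fin n → ℝ) ∉ tsupport (⇑φ) →
        τ φ = ∫ η : Fin n → ℝ, σ η * φ η) ∧
      (∀ l : ℝ, 0 < l → ∀ φ ψ : SchwartzMap (Fin n → ℝ) ℝ,
        (∀ η : Fin n → ℝ, ψ η = l ^ n * φ (l • η)) → τ ψ = l ^ (-d) * τ φ) := by
  induction m with
  | zero =>
    intro d σ hσ hhom _ hd
    obtain ⟨τ, hτ⟩ := exists_clm_eq_integral_homogeneous_mul volume hσ hhom (by simpa using hd)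
    refine ⟨τ, fun φ _ => hτ φ, fun l hl φ ψ hψ => ?_⟩
    rw [hτ, hτ]
    simp only [hψ, mul_left_comm (σ _), integral_const_mul]
    rw [integral_homogeneous_mul_comp_smul volume hhom φ hl, ← mul_assoc, ← Real.rpow_natCast,
      ← Real.rpow_add hl, Module.finrank_fin_fun]
    congr 2
    ring
  | succ m ih =>
    intro d σ hσ hhom hd hlt
    have hnd : (n : ℝ) + d ≠ 0 := fun h => hd 0 (by push_cast; linarith)
    have hj : ∀ j : Fin n, ContinuousOn (fun x : Fin n → ℝ => x j * σ x) {0}ᶜ := fun j =>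
      (continuous_apply j).continuousOn.mul hσ
    have hjhom : ∀ j : Fin n, ∀ l : ℝ, 0 < l → ∀ x : Fin n → ℝ, x ≠ 0 →
        (l • x) j * σ (l • x) = l ^ (d + 1) * (x j * σ x) := by
      intro j l hl x hx
      rw [hhom l hl x hx, Real.rpow_add hl, Real.rpow_one, Pi.smul_apply, smul_eq_mul]
      ring
    choose τ hτext hτhom using fun j : Fin n => ih (d + 1) (fun x => x j * σ x) (hj j) (hjhom j)
      (fun k hk => hd (k + 1) (by push_cast; linarith)) (by push_cast at hlt; linarith)
    let e : Fin n → Fin n → ℝ := fun j => Pi.single j 1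
    refine ⟨-((n : ℝ) + d)⁻¹ • ∑ j, (τ j).comp
      (lineDerivOpCLM ℝ (SchwartzMap (Fin n → ℝ) ℝ) (e j)), fun φ hφ => ?_,
      fun l hl φ ψ hψ => ?_⟩
    · have hsupp : ∀ j, (0 : Fin n → ℝ) ∉ tsupport (∂_{e j} φ : SchwartzMap (Fin n → ℝ) ℝ) :=
        fun j h => hφ (SchwartzMap.tsupport_lineDerivOp_subset (e j) φ h)
      have heuler := integral_homogeneous_mul_fderiv_self volume hσ hhom φ hφ
      have hsum : ∑ j, τ j (∂_{e j} φ) = ∫ x, σ x * fderiv ℝ φ x x := by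
        simp only [fun j => hτext j _ (hsupp j)]
        rw [← integral_finsetSum _ fun j _ =>
          integrable_homogeneous_mul_of_zero_notMem_tsupport volume (hj j) (hjhom j) _ (hsupp j)]
        congr 1 with x
        have hx : ∑ j, x j • e j = x := by
          simp only [e, ← Pi.single_smul, smul_eq_mul, mul_one]
          exact Finset.univ_sum_single x
        have hφx : fderiv ℝ φ x x = ∑ j, x j * fderiv ℝ φ x (e j) := by
          simpa only [hx, map_sum, map_smul, smul_eq_mul] using
            (map_sum (fderiv ℝ φ x) (fun j => x j • e j) Finset.univ)
        rw [hφx, Finset.mul_sum]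
        refine Finset.sum_congr rfl fun j _ => ?_
        rw [SchwartzMap.lineDerivOp_apply_eq_fderiv]
        ring
      simp only [smul_apply, sum_apply,
        ContinuousLinearMap.comp_apply, lineDerivOpCLM_apply, smul_eq_mul]
      rw [hsum, heuler, Module.finrank_fin_fun]
      field_simp
      ring
    · have hderiv : ∀ j, τ j (∂_{e j} ψ) = l ^ (-d) * τ j (∂_{e j} φ) := by
        intro j
        have h := hτhom j l hl (∂_{e j} φ) (l⁻¹ • ∂_{e j} ψ) fun x => ?_
        · rw [map_smul, smul_eq_mul, inv_mul_eq_iff_eq_mul₀ hl.ne', ← mul_assoc] at h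
          rw [h, neg_add, Real.rpow_add hl, Real.rpow_neg_one]
          field_simp
        · have hψ' : ⇑ψ = fun x => l ^ n * φ (l • x) := funext hψ
          have hd' : HasFDerivAt ψ (l ^ n • (fderiv ℝ φ (l • x)).comp
              (l • ContinuousLinearMap.id ℝ (Fin n → ℝ))) x := by
            rw [hψ']
            exact (φ.differentiableAt.hasFDerivAt.comp x
              ((hasFDerivAt_id x).const_smul l)).const_mul _
          rw [smul_apply, SchwartzMap.lineDerivOp_apply_eq_fderiv,
            SchwartzMap.lineDerivOp_apply_eq_fderiv, hd'.fderiv]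
          simp
          field_simp
      simp only [smul_apply, sum_apply,
        ContinuousLinearMap.comp_apply, lineDerivOpCLM_apply, hderiv, ← Finset.mul_sum]
      simp only [smul_eq_mul]
      ring


/-- Extension of a homogeneous smooth function to a homogeneous distribution
(Hörmander, Theorems 3.2.3/3.2.4): if `σ` is smooth on `ℝⁿ \ {0}` and (positively) homogeneous
of degree `d`, and `d` is not of the form `-n - k` with `k ∈ ℕ`, then there is a distribution
`τ` on `ℝⁿ` extending `σ` (i.e. agreeing with integration against `σ` on test functions vanishing
near `0`) which is homogeneous of degree `d`: `τ(φ_λ) = λ^{-d} τ(φ)` where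
`φ_λ(η) = λ^n φ(λη)`. -/
theorem homogeneous_distribution_extension (n : ℕ) (d : ℝ)
    (σ : (Fin n → ℝ) → ℝ)
    (hσ : ContDiffOn ℝ (⊤ : ℕ∞) σ {0}ᶜ)
    (hhom : ∀ l : ℝ, 0 < l → ∀ η : Fin n → ℝ, η ≠ 0 → σ (l • η) = l ^ d * σ η)
    (hd : ∀ k : ℕ, d ≠ -(n : ℝ) - (k : ℝ)) :
    ∃ τ : SchwartzMap (Fin n → ℝ) ℝ →L[ℝ] ℝ,
      (∀ φ : SchwartzMap (Fin n → ℝ) ℝ, (0 : Fin n → ℝ) ∉ tsupport (⇑φ) →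
        τ φ = ∫ η : Fin n → ℝ, σ η * φ η) ∧
      (∀ l : ℝ, 0 < l → ∀ φ ψ : SchwartzMap (Fin n → ℝ) ℝ,
        (∀ η : Fin n → ℝ, ψ η = l ^ n * φ (l • η)) → τ ψ = l ^ (-d) * τ φ) := by
  rcases Nat.eq_zero_or_pos n with rfl | hn
  · refine ⟨0, fun φ hφ => ?_, fun l _ φ ψ _ => by simp⟩
    have h0 : ∀ η : Fin 0 → ℝ, φ η = 0 := fun η => by
      rw [Subsingleton.elim η 0]
      exact image_eq_zero_of_notMem_tsupport hφ
    simp [h0]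
  · have : NeZero n := ⟨hn.ne'⟩
    obtain ⟨m, hm⟩ := exists_nat_gt (-(n : ℝ) - d)
    exact exists_homogeneous_extension_of_neg_sub_lt m d σ hσ.continuousOn hhom hd (by linarith)
end

section
/- Let σ be a smooth function on ℝⁿ \ {0} that is homogeneous of degree -n - k for some natural number k. If the obstruction integrals S(η^α σ) := ∫_{|η|=1} η^α σ(η) dη vanish for all multi-indices α with |α| = k, then σ admits an extension to a homogeneous distribution on ℝⁿ of degree -n - k. -/
open MeasureTheory

section TaylorRemainder

variable {E : Type*} [NormedAddCommGroup E] [NormedSpace ℝ E]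

/-- The degree `j` homogeneous part of the Taylor expansion of `φ` at the origin. -/
noncomputable def taylorTerm (j : ℕ) (φ : E → ℝ) (η : E) : ℝ :=
  (j.factorial : ℝ)⁻¹ * iteratedFDeriv ℝ j φ 0 (fun _ => η)

/-- `φ` minus its Taylor terms of degree less than `k`, and minus also its degree `k` term on the
closed unit ball. -/
noncomputable def taylorRemainder (k : ℕ) (φ : E → ℝ) (η : E) : ℝ :=
  φ η - ∑ j ∈ Finset.range k, taylorTerm j φ η -
    (if ‖η‖ ≤ 1 then taylorTerm k φ η else 0)

lemma iteratedDeriv_comp_smul_right {φ : E → ℝ} {j : ℕ} (hφ : ContDiff ℝ j φ) (η : E) (t : ℝ) :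
    iteratedDeriv j (fun s : ℝ => φ (s • η)) t = iteratedFDeriv ℝ j φ (t • η) (fun _ => η) := by
  have h := (ContinuousLinearMap.toSpanSingleton ℝ η).iteratedFDeriv_comp_right hφ t le_rfl
  rw [iteratedDeriv_eq_iteratedFDeriv]
  have h2 : (φ ∘ (ContinuousLinearMap.toSpanSingleton ℝ η)) = fun s : ℝ => φ (s • η) := by
    ext s; simp
  rw [h2] at h
  rw [h]
  simp

lemma taylorTerm_smul (j : ℕ) (φ : E → ℝ) (r : ℝ) (η : E) :
    taylorTerm j φ (r • η) = r ^ j * taylorTerm j φ η := by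
  have h := (iteratedFDeriv ℝ j φ 0).map_smul_univ (fun _ => r) (fun _ => η)
  simp only [Finset.prod_const, Finset.card_univ, Fintype.card_fin, smul_eq_mul] at h
  rw [taylorTerm, taylorTerm, h]
  ring

lemma taylorTerm_of_eq_comp_smul {φ ψ : E → ℝ} {j : ℕ} (hφ : ContDiff ℝ j φ)
    (hψ : ContDiff ℝ j ψ) {a l : ℝ} (h : ∀ η, ψ η = a * φ (l • η)) (η : E) :
    taylorTerm j ψ η = a * taylorTerm j φ (l • η) := by
  have h1 := iteratedDeriv_comp_smul_right hψ η 0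
  have h2 := iteratedDeriv_comp_smul_right hφ (l • η) 0
  have h3 : (fun s : ℝ => ψ (s • η)) = fun s : ℝ => a * φ (s • l • η) := by
    ext s; rw [h, smul_comm]
  rw [h3, iteratedDeriv_const_mul_field, h2, zero_smul, zero_smul] at h1
  rw [taylorTerm, taylorTerm, ← h1]
  ring

lemma taylorTerm_add {φ ψ : E → ℝ} {j : ℕ} (hφ : ContDiff ℝ j φ) (hψ : ContDiff ℝ j ψ) (η : E) :
    taylorTerm j (φ + ψ) η = taylorTerm j φ η + taylorTerm j ψ η := by
  rw [taylorTerm, iteratedFDeriv_add_apply hφ.contDiffAt hψ.contDiffAt]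
  simp only [taylorTerm, _root_.add_apply]
  ring

lemma continuous_taylorTerm (j : ℕ) (φ : E → ℝ) : Continuous (taylorTerm j φ) := by
  unfold taylorTerm
  fun_prop

lemma abs_taylorTerm_le (j : ℕ) (φ : E → ℝ) (η : E) :
    |taylorTerm j φ η| ≤ ‖iteratedFDeriv ℝ j φ 0‖ * ‖η‖ ^ j := by
  have h := (iteratedFDeriv ℝ j φ 0).le_opNorm (fun _ => η)
  simp only [Finset.prod_const, Finset.card_univ, Fintype.card_fin, Real.norm_eq_abs] at h
  rw [taylorTerm, abs_mul, abs_of_nonneg (by positivity)]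
  have h1 : (j.factorial : ℝ)⁻¹ ≤ 1 := inv_le_one_of_one_le₀ (mod_cast j.factorial_pos)
  calc _ ≤ 1 * |iteratedFDeriv ℝ j φ 0 (fun _ => η)| := by gcongr
    _ ≤ _ := by rwa [one_mul]

lemma abs_sub_sum_taylorTerm_le {φ : E → ℝ} {k : ℕ} (hφ : ContDiff ℝ (k + 1 : ℕ) φ) {C : ℝ}
    (hC : ∀ x, ‖iteratedFDeriv ℝ (k + 1) φ x‖ ≤ C) (η : E) :
    |φ η - ∑ j ∈ Finset.range (k + 1), taylorTerm j φ η| ≤ C * ‖η‖ ^ (k + 1) := by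
  have hg : ContDiff ℝ (k + 1 : ℕ) (fun s : ℝ => φ (s • η)) := by fun_prop
  have hu : UniqueDiffOn ℝ (Set.Icc (0 : ℝ) 1) := uniqueDiffOn_Icc zero_lt_one
  have hder : ∀ j ≤ k + 1, ∀ y ∈ Set.Icc (0 : ℝ) 1,
      iteratedDerivWithin j (fun s : ℝ => φ (s • η)) (Set.Icc 0 1) y =
        iteratedFDeriv ℝ j φ (y • η) (fun _ => η) := by
    intro j hj y hy
    have hj' : (j : WithTop ℕ∞) ≤ (k + 1 : ℕ) := by exact_mod_cast hj
    rw [iteratedDerivWithin_eq_iteratedDeriv hu (hg.of_le hj').contDiffAt hy,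
      iteratedDeriv_comp_smul_right (hφ.of_le hj')]
  have hC0 : 0 ≤ C := (norm_nonneg _).trans (hC 0)
  have key := taylor_mean_remainder_bound (f := fun s : ℝ => φ (s • η)) (a := 0) (b := 1) (x := 1)
    (n := k) (C := C * ‖η‖ ^ (k + 1)) zero_le_one (by exact_mod_cast hg.contDiffOn) (by simp) (by
      intro y hy
      rw [hder _ le_rfl y hy]
      refine ((iteratedFDeriv ℝ (k + 1) φ (y • η)).le_opNorm _).trans ?_
      simp only [Finset.prod_const, Finset.card_univ, Fintype.card_fin]
      gcongr
      exact hC _)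
  have hsum : taylorWithinEval (fun s : ℝ => φ (s • η)) k (Set.Icc 0 1) 0 1 =
      ∑ j ∈ Finset.range (k + 1), taylorTerm j φ η := by
    rw [taylor_within_apply]
    refine Finset.sum_congr rfl fun j hj => ?_
    rw [hder j (Finset.mem_range.1 hj).le 0 (by simp)]
    simp [taylorTerm]
  rw [hsum, Real.norm_eq_abs] at key
  simp only [one_smul, sub_zero, one_pow, mul_one] at key
  refine key.trans (div_le_self (by positivity) ?_)
  exact_mod_cast k.factorial_pos

/-- The weight dominating Taylor remainders of Schwartz functions. -/
noncomputable def remainderWeight (k : ℕ) (r : ℝ) : ℝ :=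
  if r ≤ 1 then r ^ (k + 1) else r ^ k * r⁻¹

lemma abs_taylorRemainder_le (k : ℕ) (φ : SchwartzMap E ℝ) (η : E) :
    |taylorRemainder k φ η| ≤
      (k + 1) * (Finset.Iic (1, k + 1)).sup (schwartzSeminormFamily ℝ E ℝ) φ *
        remainderWeight k ‖η‖ := by
  set S := (Finset.Iic (1, k + 1)).sup (schwartzSeminormFamily ℝ E ℝ) φ with hS
  have hS0 : 0 ≤ S := apply_nonneg _ _
  have hsemi : ∀ i j, i ≤ 1 → j ≤ k + 1 → SchwartzMap.seminorm ℝ i j φ ≤ S := by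
    intro i j hi hj
    exact Seminorm.le_def.1 (Finset.le_sup (f := schwartzSeminormFamily ℝ E ℝ)
      (b := (i, j)) (by simp [hi, hj])) φ
  have hD : ∀ j ≤ k + 1, ∀ x, ‖iteratedFDeriv ℝ j φ x‖ ≤ S := fun j hj x =>
    (φ.norm_iteratedFDeriv_le_seminorm ℝ j x).trans (hsemi 0 j zero_le_one hj)
  unfold taylorRemainder remainderWeight
  split_ifs with h
  · rw [sub_sub, ← Finset.sum_range_succ]
    refine (abs_sub_sum_taylorTerm_le (φ.smooth _) (hD (k + 1) le_rfl) η).trans ?_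
    gcongr
    nlinarith [Nat.cast_nonneg (α := ℝ) k]
  · push Not at h
    have hpos : 0 < ‖η‖ := one_pos.trans h
    rw [sub_zero]
    have h1 : |φ η| ≤ S * (‖η‖ ^ k * ‖η‖⁻¹) := by
      have h2 := (φ.norm_pow_mul_le_seminorm ℝ 1 η).trans (hsemi 1 0 le_rfl (by omega))
      rw [pow_one, Real.norm_eq_abs] at h2
      have h3 : |φ η| ≤ S * ‖η‖⁻¹ := by
        rw [← div_eq_mul_inv, le_div_iff₀ hpos]; linarith
      refine h3.trans ?_
      gcongr
      exact le_mul_of_one_le_left (by positivity) (one_le_pow₀ h.le)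
    have h2 : ∀ j ∈ Finset.range k, |taylorTerm j φ η| ≤ S * (‖η‖ ^ k * ‖η‖⁻¹) := by
      intro j hj
      have hj := Finset.mem_range.1 hj
      refine (abs_taylorTerm_le j φ η).trans ?_
      obtain ⟨m, rfl⟩ : ∃ m, k = m + 1 := ⟨k - 1, by omega⟩
      rw [pow_succ, mul_inv_cancel_right₀ hpos.ne']
      exact mul_le_mul (hD j (by omega) 0) (pow_le_pow_right₀ h.le (by omega)) (by positivity) hS0
    calc _ ≤ |φ η| + ∑ j ∈ Finset.range k, |taylorTerm j φ η| :=
          (abs_sub _ _).trans (by gcongr; exact Finset.abs_sum_le_sum_abs _ _)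
      _ ≤ S * (‖η‖ ^ k * ‖η‖⁻¹) + ∑ j ∈ Finset.range k, S * (‖η‖ ^ k * ‖η‖⁻¹) := by
          gcongr with j hj; exact h2 j hj
      _ = _ := by simp; ring

lemma taylorRemainder_add (k : ℕ) (φ ψ : SchwartzMap E ℝ) (η : E) :
    taylorRemainder k (φ + ψ : SchwartzMap E ℝ) η =
      taylorRemainder k φ η + taylorRemainder k ψ η := by
  have h : ∀ j, taylorTerm j (φ + ψ : SchwartzMap E ℝ) η =
      taylorTerm j φ η + taylorTerm j ψ η := fun j =>
    taylorTerm_add (φ.smooth j) (ψ.smooth j) η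
  simp only [taylorRemainder, h, Finset.sum_add_distrib, _root_.add_apply]
  split_ifs <;> ring

lemma taylorRemainder_smul (k : ℕ) (a : ℝ) (φ : SchwartzMap E ℝ) (η : E) :
    taylorRemainder k (a • φ : SchwartzMap E ℝ) η = a * taylorRemainder k φ η := by
  have h : ∀ j, taylorTerm j (a • φ : SchwartzMap E ℝ) η = a * taylorTerm j φ η := fun j => by
    simpa using taylorTerm_of_eq_comp_smul (φ.smooth j) ((a • φ).smooth j) (a := a) (l := 1)
      (by simp) η
  simp only [taylorRemainder, h, ← Finset.mul_sum, _root_.smul_apply, smul_eq_mul]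
  split_ifs <;> ring

lemma taylorRemainder_of_eq_comp_smul (k : ℕ) {φ ψ : SchwartzMap E ℝ} {a l : ℝ} (hl : 0 < l)
    (h : ∀ η, ψ η = a * φ (l • η)) (η : E) :
    taylorRemainder k ψ η = a * (taylorRemainder k φ (l • η) +
      ((if ‖l • η‖ ≤ 1 then 1 else 0) - (if ‖l • η‖ ≤ l then 1 else 0)) *
        taylorTerm k φ (l • η)) := by
  have ht : ∀ j, taylorTerm j ψ η = a * taylorTerm j φ (l • η) := fun j =>
    taylorTerm_of_eq_comp_smul (φ.smooth j) (ψ.smooth j) h η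
  have hn : ‖l • η‖ ≤ l ↔ ‖η‖ ≤ 1 := by
    rw [norm_smul, Real.norm_of_nonneg hl.le]
    exact mul_le_iff_le_one_right hl
  simp only [taylorRemainder, ht, ← Finset.mul_sum, h, hn]
  split_ifs <;> ring

lemma taylorRemainder_of_notMem_tsupport (k : ℕ) {φ : E → ℝ} (h : (0 : E) ∉ tsupport φ) (η : E) :
    taylorRemainder k φ η = φ η := by
  have ht : ∀ j, taylorTerm j φ η = 0 := fun j => by
    have h0 : iteratedFDeriv ℝ j φ 0 = 0 :=
      image_eq_zero_of_notMem_tsupport fun h' => h (tsupport_iteratedFDeriv_subset j h')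
    simp [taylorTerm, h0]
  simp [taylorRemainder, ht]

lemma measurable_taylorRemainder [MeasurableSpace E] [BorelSpace E] (k : ℕ)
    {φ : E → ℝ} (hφ : Continuous φ) : Measurable (taylorRemainder k φ) := by
  have ht : ∀ j, Measurable (taylorTerm j φ) := fun j => (continuous_taylorTerm j φ).measurable
  refine (hφ.measurable.sub (Finset.measurable_fun_sum _ fun j _ => ht j)).sub ?_
  exact Measurable.ite (measurableSet_le continuous_norm.measurable measurable_const) (ht k)
    measurable_const

end TaylorRemainder

section Polar

variable {E : Type*} [NormedAddCommGroup E] [NormedSpace ℝ E] [FiniteDimensional ℝ E]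
  [MeasurableSpace E] [BorelSpace E] [Nontrivial E] (μ : Measure E) [μ.IsAddHaarMeasure]

lemma integral_eq_zero_of_integral_toSphere_eq_zero {f g : E → ℝ} {a : ℝ → ℝ}
    (hf : ∀ r : ℝ, 0 < r → ∀ ω : E, ‖ω‖ = 1 → f (r • ω) = a r * g ω)
    (hg : ∫ ω : Metric.sphere (0 : E) 1, g ω ∂μ.toSphere = 0) : ∫ η, f η ∂μ = 0 := by
  calc ∫ η, f η ∂μ = ∫ x : ({(0)}ᶜ : Set E), f x.1 ∂(μ.comap (↑)) := by
        rw [integral_subtype_comap (measurableSet_singleton _).compl f,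
          restrict_compl_singleton]
    _ = ∫ x, g x.1 * a x.2 ∂μ.toSphere.prod (.volumeIoiPow (Module.finrank ℝ E - 1)) := by
        rw [← μ.measurePreserving_homeomorphUnitSphereProd.integral_comp
          (Homeomorph.measurableEmbedding _)]
        refine integral_congr_ae (.of_forall fun x => ?_)
        have hx : 0 < ‖x.1‖ := norm_pos_iff.2 x.2
        have h := hf ‖x.1‖ hx (‖x.1‖⁻¹ • x.1) (by
          rw [norm_smul, norm_inv, norm_norm, inv_mul_cancel₀ hx.ne'])
        rw [smul_inv_smul₀ hx.ne'] at h
        simp [h, mul_comm]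
    _ = 0 := by
        rw [integral_prod_mul (fun ω : Metric.sphere (0 : E) 1 => g ω)
          (fun r : Set.Ioi (0 : ℝ) => a r), hg, zero_mul]

lemma integrable_inv_pow_mul_remainderWeight (k : ℕ) :
    Integrable (fun η : E => (‖η‖ ^ (Module.finrank ℝ E + k))⁻¹ * remainderWeight k ‖η‖) μ := by
  rw [integrable_fun_norm_addHaar μ
    (f := fun r => (r ^ (Module.finrank ℝ E + k))⁻¹ * remainderWeight k r)]
  obtain ⟨m, hm⟩ : ∃ m, Module.finrank ℝ E = m + 1 :=
    ⟨_, (Nat.succ_pred_eq_of_pos Module.finrank_pos).symm⟩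
  rw [← Set.Ioc_union_Ioi_eq_Ioi (zero_le_one' ℝ), integrableOn_union, hm]
  constructor
  · refine (integrableOn_const (C := (1 : ℝ)) (by simp)).congr_fun ?_ measurableSet_Ioc
    intro r hr
    have h0 : r ≠ 0 := hr.1.ne'
    simp only [remainderWeight, if_pos hr.2, Nat.add_sub_cancel, smul_eq_mul]
    field_simp
    ring
  · refine (integrableOn_Ioi_rpow_of_lt (a := -2) (by norm_num) one_pos).congr_fun ?_
      measurableSet_Ioi
    intro r hr
    have h1 : 1 < r := hr
    have h0 : r ≠ 0 := by positivity
    simp only [remainderWeight, if_neg h1.not_ge, Nat.add_sub_cancel, smul_eq_mul]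
    rw [Real.rpow_neg (by positivity), Real.rpow_ofNat]
    field_simp
    ring

end Polar

section Homogeneous

variable {n k : ℕ} {σ : EuclideanSpace ℝ (Fin n) → ℝ}

lemma integral_mul_multilinear_eq_zero
    {μ : Measure (Metric.sphere (0 : EuclideanSpace ℝ (Fin n)) 1)}
    [IsFiniteMeasure μ] (hσ : ContinuousOn σ {0}ᶜ)
    (hobstruction : ∀ α : Fin n → ℕ, (∑ i, α i) = k →
      ∫ η : Metric.sphere (0 : EuclideanSpace ℝ (Fin n)) 1,
        (∏ i, ((η : EuclideanSpace ℝ (Fin n)) i) ^ (α i)) * σ η ∂μ = 0)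
    (L : ContinuousMultilinearMap ℝ (fun _ : Fin k => EuclideanSpace ℝ (Fin n)) ℝ) :
    ∫ η : Metric.sphere (0 : EuclideanSpace ℝ (Fin n)) 1, σ η * L (fun _ => η) ∂μ = 0 := by
  have hσc : Continuous fun η : Metric.sphere (0 : EuclideanSpace ℝ (Fin n)) 1 => σ η :=
    hσ.comp_continuous continuous_subtype_val fun η => ne_zero_of_mem_unit_sphere η
  let e : Fin n → EuclideanSpace ℝ (Fin n) := fun i => EuclideanSpace.single i 1
  have hexp : ∀ η : EuclideanSpace ℝ (Fin n), L (fun _ => η) =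
      ∑ r : Fin k → Fin n, (∏ i, η i ^ (Finset.univ.filter fun j => r j = i).card) *
        L (fun j => e (r j)) := by
    intro η
    have h1 : η = ∑ i, η i • e i := by
      ext j
      simp [e, Pi.single_apply]
    have h2 : L (fun _ => η) = L (fun _ => ∑ i, η i • e i) := by rw [← h1]
    rw [h2, L.map_sum]
    refine Finset.sum_congr rfl fun r _ => ?_
    rw [L.map_smul_univ (fun j => η (r j)) (fun j => e (r j)), smul_eq_mul]
    congr 1
    rw [← Finset.prod_fiberwise Finset.univ r]
    refine Finset.prod_congr rfl fun i _ => ?_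
    rw [← Finset.prod_const]
    exact Finset.prod_congr rfl fun j hj => by rw [(Finset.mem_filter.1 hj).2]
  have hcongr : ∀ η : Metric.sphere (0 : EuclideanSpace ℝ (Fin n)) 1, σ η * L (fun _ => η) =
      ∑ r : Fin k → Fin n,
        ((∏ i, (η : EuclideanSpace ℝ (Fin n)) i ^ (Finset.univ.filter fun j => r j = i).card) *
          σ η) * L (fun j => e (r j)) := by
    intro η
    rw [hexp, Finset.mul_sum]
    exact Finset.sum_congr rfl fun r _ => by ring
  simp_rw [hcongr]
  rw [integral_finsetSum]
  · refine Finset.sum_eq_zero fun r _ => ?_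
    rw [integral_mul_const, hobstruction, zero_mul]
    simpa using (Finset.card_eq_sum_card_fiberwise (f := r) (s := Finset.univ)
      (t := Finset.univ) (by simp)).symm
  · intro r _
    refine Integrable.mul_const ?_ _
    have hc : Continuous fun η : Metric.sphere (0 : EuclideanSpace ℝ (Fin n)) 1 =>
        (∏ i, (η : EuclideanSpace ℝ (Fin n)) i ^ (Finset.univ.filter fun j => r j = i).card) *
          σ η :=
      (continuous_finsetProd _ fun i _ => by fun_prop).mul hσc
    exact hc.integrable_of_hasCompactSupport (HasCompactSupport.of_compactSpace _)

lemma exists_abs_le_mul_inv_pow {m : ℕ} (hσ : ContinuousOn σ {0}ᶜ)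
    (hhom : ∀ l : ℝ, 0 < l → ∀ η : EuclideanSpace ℝ (Fin n), η ≠ 0 →
      σ (l • η) = (l ^ m)⁻¹ * σ η) :
    ∃ M, 0 ≤ M ∧ ∀ η, η ≠ 0 → |σ η| ≤ M * (‖η‖ ^ m)⁻¹ := by
  obtain ⟨M, hM⟩ := (isCompact_sphere (0 : EuclideanSpace ℝ (Fin n)) 1).exists_bound_of_continuousOn
    (hσ.mono fun η hη => ne_zero_of_mem_unit_sphere ⟨η, hη⟩)
  refine ⟨max M 0, le_max_right _ _, fun η hη => ?_⟩
  have hp : 0 < ‖η‖ := norm_pos_iff.2 hη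
  have h := hhom ‖η‖ hp (‖η‖⁻¹ • η) (smul_ne_zero (inv_ne_zero hp.ne') hη)
  rw [smul_inv_smul₀ hp.ne'] at h
  have h2 := hM (‖η‖⁻¹ • η) (by
    simp [norm_smul, inv_mul_cancel₀ hp.ne'])
  rw [h, abs_mul, abs_of_nonneg (by positivity), mul_comm]
  gcongr
  exact h2.trans (le_max_left _ _)

end Homogeneous

/-- The critical-degree case of the extension of homogeneous functions to homogeneous
distributions: let `σ` be smooth on `ℝⁿ \ {0}` and homogeneous of degree `d = -n - k`, `k ∈ ℕ`.
If all obstruction integrals `S(η^α σ) = ∫_{|η|=1} η^α σ(η) dη` with `|α| = k` vanish, then `σ`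
extends to a distribution `τ` on `ℝⁿ` homogeneous of degree `-n - k`
(`τ(φ_λ) = λ^{n+k} τ(φ)` for `φ_λ(η) = λ^n φ(λη)`). -/
theorem homogeneous_distribution_extension_critical (n k : ℕ)
    (σ : EuclideanSpace ℝ (Fin n) → ℝ)
    (hσ : ContDiffOn ℝ (⊤ : ℕ∞) σ {0}ᶜ)
    (hhom : ∀ l : ℝ, 0 < l → ∀ η : EuclideanSpace ℝ (Fin n), η ≠ 0 →
      σ (l • η) = l ^ (-(n : ℝ) - (k : ℝ)) * σ η)
    (hobstruction : ∀ α : Fin n → ℕ, (∑ i, α i) = k →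
      ∫ η : Metric.sphere (0 : EuclideanSpace ℝ (Fin n)) 1,
          (∏ i, ((η : EuclideanSpace ℝ (Fin n)) i) ^ (α i)) * σ η
        ∂((volume : Measure (EuclideanSpace ℝ (Fin n))).toSphere) = 0) :
    ∃ τ : SchwartzMap (EuclideanSpace ℝ (Fin n)) ℝ →L[ℝ] ℝ,
      (∀ φ : SchwartzMap (EuclideanSpace ℝ (Fin n)) ℝ,
        (0 : EuclideanSpace ℝ (Fin n)) ∉ tsupport (⇑φ) →
        τ φ = ∫ η : EuclideanSpace ℝ (Fin n), σ η * φ η) ∧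
      (∀ l : ℝ, 0 < l → ∀ φ ψ : SchwartzMap (EuclideanSpace ℝ (Fin n)) ℝ,
        (∀ η : EuclideanSpace ℝ (Fin n), ψ η = l ^ n * φ (l • η)) →
        τ ψ = l ^ ((n : ℝ) + (k : ℝ)) * τ φ) := by
  have hhom' : ∀ l : ℝ, 0 < l → ∀ η : EuclideanSpace ℝ (Fin n), η ≠ 0 →
      σ (l • η) = (l ^ (n + k))⁻¹ * σ η := by
    intro l hl η hη
    rw [hhom l hl η hη, show -(n : ℝ) - (k : ℝ) = -((n + k : ℕ) : ℝ) by push_cast; ring,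
      Real.rpow_neg hl.le, Real.rpow_natCast]
  rcases Nat.eq_zero_or_pos n with rfl | hn
  · refine ⟨0, fun φ hφ => ?_, by simp⟩
    have h : ∀ η, φ η = 0 := fun η => by
      rw [Subsingleton.elim η 0]
      exact image_eq_zero_of_notMem_tsupport hφ
    simp [h]
  have : Nonempty (Fin n) := ⟨⟨0, hn⟩⟩
  have hσc : ContinuousOn σ {0}ᶜ := hσ.continuousOn
  obtain ⟨M, hM0, hM⟩ := exists_abs_le_mul_inv_pow hσc hhom'
  have hae : ∀ᵐ η : EuclideanSpace ℝ (Fin n), η ≠ 0 := by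
    simp [ae_iff]
  have hσm : AEStronglyMeasurable σ (volume : Measure (EuclideanSpace ℝ (Fin n))) := by
    have h := hσc.aestronglyMeasurable (μ := volume) (measurableSet_singleton _).compl
    rwa [restrict_compl_singleton] at h
  let h : EuclideanSpace ℝ (Fin n) → ℝ := fun η => (‖η‖ ^ (n + k))⁻¹ * remainderWeight k ‖η‖
  have hh : Integrable h := by
    simpa using integrable_inv_pow_mul_remainderWeight
      (volume : Measure (EuclideanSpace ℝ (Fin n))) k
  let S : SchwartzMap (EuclideanSpace ℝ (Fin n)) ℝ → ℝ := fun φ =>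
    (Finset.Iic (1, k + 1)).sup (schwartzSeminormFamily ℝ (EuclideanSpace ℝ (Fin n)) ℝ) φ
  have hbound : ∀ φ : SchwartzMap (EuclideanSpace ℝ (Fin n)) ℝ,
      ∀ᵐ η, ‖σ η * taylorRemainder k φ η‖ ≤ (M * ((k + 1) * S φ)) * h η := by
    intro φ
    filter_upwards [hae] with η hη
    rw [Real.norm_eq_abs, abs_mul]
    calc |σ η| * |taylorRemainder k φ η|
        ≤ (M * (‖η‖ ^ (n + k))⁻¹) * ((k + 1) * S φ * remainderWeight k ‖η‖) :=
          mul_le_mul (hM η hη) (abs_taylorRemainder_le k φ η) (abs_nonneg _) (by positivity)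
      _ = _ := by simp only [h]; ring
  have hint : ∀ φ : SchwartzMap (EuclideanSpace ℝ (Fin n)) ℝ,
      Integrable fun η => σ η * taylorRemainder k φ η := fun φ =>
    (hh.const_mul _).mono'
      (hσm.mul (measurable_taylorRemainder k φ.continuous).aestronglyMeasurable) (hbound φ)
  let τ : SchwartzMap (EuclideanSpace ℝ (Fin n)) ℝ →L[ℝ] ℝ :=
    SchwartzMap.mkCLMtoNormedSpace (fun φ => ∫ η, σ η * taylorRemainder k φ η)
      (fun φ ψ => by
        rw [← integral_add (hint φ) (hint ψ)]
        simp_rw [taylorRemainder_add, mul_add])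
      (fun a φ => by
        simp_rw [taylorRemainder_smul, mul_left_comm, integral_const_mul]
        rfl)
      ⟨Finset.Iic (1, k + 1), M * (k + 1) * |∫ η, h η|, by positivity, fun φ => by
        refine (norm_integral_le_of_norm_le (hh.const_mul _) (hbound φ)).trans ?_
        rw [integral_const_mul]
        have hS0 : 0 ≤ S φ := apply_nonneg _ _
        calc M * ((k + 1) * S φ) * ∫ η, h η ≤ M * ((k + 1) * S φ) * |∫ η, h η| := by
              gcongr; exact le_abs_self _
          _ = _ := by simp only [S]; ring⟩
  have hτ : ∀ φ, τ φ = ∫ η, σ η * taylorRemainder k φ η := fun φ => rfl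
  refine ⟨τ, fun φ hφ => ?_, fun l hl φ ψ hψ => ?_⟩
  · simp_rw [hτ, taylorRemainder_of_notMem_tsupport k hφ]
  let c : ℝ → ℝ := fun r => (if r ≤ 1 then 1 else 0) - (if r ≤ l then 1 else 0)
  let G : EuclideanSpace ℝ (Fin n) → ℝ := fun η => c ‖η‖ * (σ η * taylorTerm k φ η)
  have hG0 : ∫ η, G η = 0 := by
    refine integral_eq_zero_of_integral_toSphere_eq_zero volume
      (g := fun ω => σ ω * taylorTerm k φ ω) (a := fun r => c r * ((r ^ (n + k))⁻¹ * r ^ k)) ?_ ?_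
    · intro r hr ω hω
      simp only [G]
      rw [hhom' r hr ω (norm_ne_zero_iff.1 (by simp [hω])), taylorTerm_smul, norm_smul, hω, mul_one,
        Real.norm_of_nonneg hr.le]
      ring
    · simp_rw [taylorTerm, mul_left_comm _ ((k.factorial : ℝ)⁻¹), integral_const_mul]
      rw [integral_mul_multilinear_eq_zero hσc hobstruction, mul_zero]
  have hpt : ∀ᵐ η, σ η * taylorRemainder k ψ η =
      (l ^ n * l ^ (n + k)) * (σ (l • η) * taylorRemainder k φ (l • η) + G (l • η)) := by
    filter_upwards [hae] with η hη
    rw [taylorRemainder_of_eq_comp_smul k hl hψ]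
    simp only [G, c, hhom' l hl η hη]
    have : l ^ (n + k) ≠ 0 := by positivity
    field_simp
  have hl0 : l ^ n * l ^ (n + k) ≠ 0 := by positivity
  have hsum : Integrable fun η => σ η * taylorRemainder k φ η + G η := by
    rw [← integrable_comp_smul_iff volume _ hl.ne']
    exact (integrable_const_mul_iff (isUnit_iff_ne_zero.2 hl0) _).1 ((hint ψ).congr hpt)
  have hG : Integrable G := by
    refine (hsum.sub (hint φ)).congr (.of_forall fun η => ?_)
    simp
  rw [hτ, hτ, integral_congr_ae hpt, integral_const_mul,
    Measure.integral_comp_smul volume (fun η => σ η * taylorRemainder k φ η + G η),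
    integral_add (hint φ) hG, hG0, add_zero, finrank_euclideanSpace_fin,
    abs_of_nonneg (by positivity), smul_eq_mul, ← Nat.cast_add, Real.rpow_natCast]
  field_simp
end

section
/- Let N_A(λ) = ∑_{λ_j ≤ λ} ⟨Aψ_j, ψ_j⟩ for a positive self-adjoint operator with discrete spectrum λ_1 ≤ λ_2 ≤ …, and suppose the zeta function ζ_A(z) = ∑_j ⟨Aψ_j,ψ_j⟩ λ_j^{z} (with ⟨Aψ_j,ψ_j⟩ ≥ 0), convergent for Re z < -n, extends meromorphically to Re z < -n + 1 with a single simple pole at z = -n of residue r > 0. Then N_A(λ) ~ (r/n) λ^n as λ → +∞. -/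
open Filter Complex
open MeasureTheory FourierTransform Topology

/-- The tent function `ξ ↦ max 0 (1 - |ξ|)`. -/
noncomputable def tent (ξ : ℝ) : ℂ := ((max 0 (1 - |ξ|) : ℝ) : ℂ)

lemma continuous_tent : Continuous tent := by unfold tent; fun_prop

lemma tent_eq_zero {ξ : ℝ} (h : ξ ∉ Set.Ioc (-1 : ℝ) 1) : tent ξ = 0 := by
  have : 1 - |ξ| ≤ 0 := by
    by_contra! h'
    have := abs_lt.1 (sub_pos.1 h')
    exact h ⟨this.1, this.2.le⟩
  simp [tent, this]

lemma integrable_tent : Integrable tent :=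
  continuous_tent.integrable_of_hasCompactSupport <|
    HasCompactSupport.intro (K := Set.Icc (-1 : ℝ) 1) isCompact_Icc
      fun _ h => tent_eq_zero fun h' => h (Set.Ioc_subset_Icc_self h')

/-- The Fejér kernel, i.e. the Fourier transform of the tent function. -/
noncomputable def fejer (x : ℝ) : ℝ := (𝓕 tent x).re

lemma fourier_tent_of_ne_zero {x : ℝ} (hx : x ≠ 0) :
    𝓕 tent x = ((2 * (1 - Real.cos (2 * Real.pi * x)) / (2 * Real.pi * x) ^ 2 : ℝ) : ℂ) := by
  set θ : ℂ := -(2 * Real.pi * x : ℝ) * I with hθ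
  have hx' : (2 * Real.pi * x : ℝ) ≠ 0 := by positivity
  have hθ0 : θ ≠ 0 := by
    rw [hθ]; exact mul_ne_zero (neg_ne_zero.2 (by exact_mod_cast hx')) I_ne_zero
  have hcont : Continuous fun v : ℝ => cexp (θ * v) * tent v :=
    (by fun_prop : Continuous fun v : ℝ => cexp (θ * v)).mul continuous_tent
  have hexp (v : ℝ) : HasDerivAt (fun v : ℝ => cexp (θ * v)) (cexp (θ * v) * θ) v := by
    simpa using ((hasDerivAt_id v).ofReal_comp.const_mul θ).cexp
  have h1 : 𝓕 tent x = ∫ v in (-1 : ℝ)..1, cexp (θ * v) * tent v := by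
    rw [Real.fourier_eq', intervalIntegral.integral_of_le (by norm_num),
      setIntegral_eq_integral_of_forall_compl_eq_zero
        fun v hv => by rw [tent_eq_zero hv, mul_zero]]
    refine integral_congr_ae (Eventually.of_forall fun v => ?_)
    simp only [smul_eq_mul, hθ]
    congr 2
    simp
    ring
  have h2 : ∫ v in (-1 : ℝ)..0, cexp (θ * v) * tent v
      = 1 / θ - 1 / θ ^ 2 + cexp (-θ) / θ ^ 2 := by
    rw [intervalIntegral.integral_eq_sub_of_hasDerivAt
      (f := fun v : ℝ => (1 + v) * cexp (θ * v) / θ - cexp (θ * v) / θ ^ 2)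
      (fun v hv => ?_) (hcont.intervalIntegrable _ _)]
    · simp
    · rw [Set.uIcc_of_le (by norm_num)] at hv
      have : tent v = 1 + v := by
        rw [tent, abs_of_nonpos hv.2, max_eq_right (by linarith [hv.1])]; simp
      rw [this]
      have := (((((hasDerivAt_id v).ofReal_comp.const_add (1 : ℂ)).mul (hexp v)).div_const θ).sub
        ((hexp v).div_const (θ ^ 2)))
      refine HasDerivAt.congr_deriv this ?_
      simp only [id_eq, ofReal_one]
      field_simp
      ring
  have h3 : ∫ v in (0 : ℝ)..1, cexp (θ * v) * tent v
      = cexp θ / θ ^ 2 - 1 / θ - 1 / θ ^ 2 := by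
    rw [intervalIntegral.integral_eq_sub_of_hasDerivAt
      (f := fun v : ℝ => (1 - v) * cexp (θ * v) / θ + cexp (θ * v) / θ ^ 2)
      (fun v hv => ?_) (hcont.intervalIntegrable _ _)]
    · simp; ring
    · rw [Set.uIcc_of_le (by norm_num)] at hv
      have : tent v = 1 - v := by
        rw [tent, abs_of_nonneg hv.1, max_eq_right (by linarith [hv.2])]; simp
      rw [this]
      have := (((((hasDerivAt_id v).ofReal_comp.const_sub (1 : ℂ)).mul (hexp v)).div_const θ).add
        ((hexp v).div_const (θ ^ 2)))
      refine HasDerivAt.congr_deriv this ?_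
      simp only [id_eq, ofReal_one]
      field_simp
      ring
  rw [h1, ← intervalIntegral.integral_add_adjacent_intervals
    (hcont.intervalIntegrable (-1) 0) (hcont.intervalIntegrable 0 1), h2, h3]
  have h4 : cexp θ + cexp (-θ) = 2 * Complex.cos (2 * Real.pi * x : ℝ) := by
    rw [Complex.two_cos, hθ]; ring_nf
  have h5 : θ ^ 2 = -((2 * Real.pi * x : ℝ) : ℂ) ^ 2 := by
    rw [hθ, mul_pow, I_sq]; ring
  have h6 : ((2 * Real.pi * x : ℝ) : ℂ) ^ 2 ≠ 0 := pow_ne_zero _ (by exact_mod_cast hx')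
  calc _ = (cexp θ + cexp (-θ) - 2) / θ ^ 2 := by ring
    _ = _ := by
      rw [h4, h5]
      generalize 2 * Real.pi * x = q at h6
      push_cast
      field_simp
      ring

lemma fejer_of_ne_zero {x : ℝ} (hx : x ≠ 0) :
    fejer x = 2 * (1 - Real.cos (2 * Real.pi * x)) / (2 * Real.pi * x) ^ 2 := by
  rw [fejer, fourier_tent_of_ne_zero hx, ofReal_re]

lemma fourier_tent_zero : 𝓕 tent 0 = (∫ v, max 0 (1 - |v|) : ℝ) := by
  rw [Real.fourier_eq', ← integral_complex_ofReal]
  simp [tent]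

lemma fourier_tent (x : ℝ) : 𝓕 tent x = (fejer x : ℂ) := by
  rcases eq_or_ne x 0 with rfl | hx
  · rw [fejer, fourier_tent_zero, ofReal_re]
  · rw [fejer_of_ne_zero hx, fourier_tent_of_ne_zero hx]

lemma fejer_nonneg (x : ℝ) : 0 ≤ fejer x := by
  rcases eq_or_ne x 0 with rfl | hx
  · rw [fejer, fourier_tent_zero, ofReal_re]
    exact integral_nonneg fun v => le_max_left _ _
  · rw [fejer_of_ne_zero hx]
    have := Real.cos_le_one (2 * Real.pi * x)
    have : 0 ≤ 1 - Real.cos (2 * Real.pi * x) := by linarith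
    positivity

lemma fejer_pos {x : ℝ} (hx : x ∈ Set.Ioo (0 : ℝ) 1) : 0 < fejer x := by
  rw [fejer_of_ne_zero hx.1.ne']
  have h0 := hx.1
  have h : Real.cos (2 * Real.pi * x) ≠ 1 := fun h => by
    rw [Real.cos_eq_one_iff] at h
    obtain ⟨k, hk⟩ := h
    have : (k : ℝ) = x := by
      have := Real.pi_pos
      have h2 : (2 * Real.pi) * ((k : ℝ) - x) = 0 := by linarith
      rcases mul_eq_zero.1 h2 with h | h
      · linarith
      · linarith
    have h1 : (0 : ℝ) < k := this ▸ hx.1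
    have h2 : (k : ℝ) < 1 := this ▸ hx.2
    norm_cast at h1 h2
    omega
  have : 0 < 1 - Real.cos (2 * Real.pi * x) :=
    sub_pos.2 (lt_of_le_of_ne (Real.cos_le_one _) h)
  positivity

lemma continuous_fejer : Continuous fejer :=
  continuous_re.comp (VectorFourier.fourierIntegral_continuous Real.continuous_fourierChar
    (by exact continuous_inner) integrable_tent)

lemma integrable_fejer : Integrable fejer := by
  set M := ∫ v, ‖tent v‖ with hM
  refine (integrable_inv_one_add_sq.const_mul (M + 1)).mono'
    continuous_fejer.aestronglyMeasurable (Eventually.of_forall fun x => ?_)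
  rw [Real.norm_of_nonneg (fejer_nonneg x), ← div_eq_mul_inv, le_div_iff₀ (by positivity)]
  have h1 : fejer x ≤ M := (re_le_norm _).trans (VectorFourier.norm_fourierIntegral_le_integral_norm _ _ _ _ _)
  have h2 : fejer x * x ^ 2 ≤ 1 := by
    rcases eq_or_ne x 0 with rfl | hx
    · simp
    · rw [fejer_of_ne_zero hx]
      have : 2 * (1 - Real.cos (2 * Real.pi * x)) / (2 * Real.pi * x) ^ 2 * x ^ 2
          = (1 - Real.cos (2 * Real.pi * x)) / (2 * Real.pi ^ 2) := by
        field_simp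
      rw [this, div_le_one (by positivity)]
      nlinarith [Real.pi_gt_three, Real.neg_one_le_cos (2 * Real.pi * x)]
  linarith

lemma integral_fejer_unit_pos : 0 < ∫ x in (0 : ℝ)..1, fejer x :=
  intervalIntegral.intervalIntegral_pos_of_pos_on
    (continuous_fejer.intervalIntegrable _ _) (fun _ hx => fejer_pos hx) one_pos

lemma integral_fejer_pos : 0 < ∫ x, fejer x := by
  refine integral_fejer_unit_pos.trans_le ?_
  rw [intervalIntegral.integral_of_le zero_le_one]
  exact setIntegral_le_integral integrable_fejer (Eventually.of_forall fejer_nonneg)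

/-- Parseval's formula for the modulated tent function. -/
lemma integral_mul_fejer {f : ℝ → ℂ} (hf : Integrable f) (y : ℝ) :
    ∫ x, f x * (fejer (x - y) : ℂ) = ∫ ξ, 𝐞 (-(ξ * -y)) • (𝓕 f ξ * tent ξ) := by
  set g : ℝ → ℂ := fun ξ => (𝐞 (ξ * y) : ℂ) * tent ξ with hg
  have hgi : Integrable g := by
    have : Continuous g := (by fun_prop : Continuous fun ξ : ℝ => (𝐞 (ξ * y) : ℂ)).mul continuous_tent
    refine this.integrable_of_hasCompactSupport <|
      HasCompactSupport.intro (K := Set.Icc (-1 : ℝ) 1) isCompact_Icc fun ξ h => ?_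
    rw [hg]; simp only [tent_eq_zero fun h' => h (Set.Ioc_subset_Icc_self h'), mul_zero]
  have h := VectorFourier.integral_fourierIntegral_smul_eq_flip (L := innerₗ ℝ)
    (μ := volume) (ν := volume) Real.continuous_fourierChar
    (by exact continuous_inner) hf hgi
  have hgF (x : ℝ) : 𝓕 g x = fejer (x - y) := by
    rw [← fourier_tent, Real.fourier_eq, Real.fourier_eq]
    refine integral_congr_ae (Eventually.of_forall fun v => ?_)
    simp only [hg, Circle.smul_def, smul_eq_mul, ← mul_assoc]
    rw [← Circle.coe_mul, ← AddChar.map_add_eq_mul]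
    congr 3
    simp
    ring
  calc _ = ∫ x, f x • 𝓕 g x := by simp_rw [hgF, smul_eq_mul]
    _ = ∫ ξ, 𝓕 f ξ • g ξ := by rw [flip_innerₗ] at h; exact h.symm
    _ = _ := by
      refine integral_congr_ae (Eventually.of_forall fun v => ?_)
      simp only [hg, Circle.smul_def, smul_eq_mul, mul_neg, neg_neg]
      ring

section Tauberian

variable {a A x₀ : ℝ} {S : ℝ → ℝ} {H : ℂ → ℂ}

lemma continuous_comp_vertical (hH : ContinuousOn H {s | 0 ≤ s.re}) :
    Continuous fun p : ℝ × ℝ => H ((max p.1 0 : ℝ) + (2 * Real.pi * p.2 : ℝ) * I) :=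
  hH.comp_continuous (by fun_prop) fun p => by simp

/-- The smoothed boundary function of a Laplace transform. -/
noncomputable def boundaryIntegral (H : ℂ → ℂ) (ε y : ℝ) : ℂ :=
  ∫ ξ : ℝ, 𝐞 (-(ξ * -y)) • (H ((max ε 0 : ℝ) + (2 * Real.pi * ξ : ℝ) * I) * tent ξ)

lemma exists_bound_boundary (hH : ContinuousOn H {s | 0 ≤ s.re}) :
    ∃ C, ∀ ε ≤ 1, ∀ ξ : ℝ,
      ‖H ((max ε 0 : ℝ) + (2 * Real.pi * ξ : ℝ) * I) * tent ξ‖ ≤ C * ‖tent ξ‖ := by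
  obtain ⟨C, hC⟩ := (isCompact_Icc.prod isCompact_Icc :
    IsCompact (Set.Icc (0 : ℝ) 1 ×ˢ Set.Icc (-1 : ℝ) 1)).exists_bound_of_continuousOn
      (continuous_comp_vertical hH).continuousOn
  refine ⟨C, fun ε hε ξ => ?_⟩
  rw [norm_mul]
  by_cases hξ : ξ ∈ Set.Ioc (-1 : ℝ) 1
  · gcongr
    simpa using hC (max ε 0, ξ) ⟨⟨le_max_right _ _, max_le hε zero_le_one⟩,
      Set.Ioc_subset_Icc_self hξ⟩
  · simp [tent_eq_zero hξ]

lemma exists_bound_boundaryIntegral (hH : ContinuousOn H {s | 0 ≤ s.re}) :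
    ∃ C, ∀ ε ≤ 1, ∀ y, ‖boundaryIntegral H ε y‖ ≤ C := by
  obtain ⟨C, hC⟩ := exists_bound_boundary hH
  refine ⟨∫ ξ, C * ‖tent ξ‖, fun ε hε y => ?_⟩
  refine norm_integral_le_of_norm_le (integrable_tent.norm.const_mul C)
    (Eventually.of_forall fun ξ => ?_)
  rw [Circle.norm_smul]
  exact hC ε hε ξ

lemma tendsto_boundaryIntegral_zero (hH : ContinuousOn H {s | 0 ≤ s.re}) (y : ℝ) :
    Tendsto (fun ε => boundaryIntegral H ε y) (𝓝[>] 0) (𝓝 (boundaryIntegral H 0 y)) := by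
  obtain ⟨C, hC⟩ := exists_bound_boundary hH
  have hcont := continuous_comp_vertical hH
  refine tendsto_integral_filter_of_dominated_convergence (fun ξ => C * ‖tent ξ‖) ?_ ?_
    (integrable_tent.norm.const_mul C) (Eventually.of_forall fun ξ => ?_)
  · refine Eventually.of_forall fun ε => Continuous.aestronglyMeasurable ?_
    have h1 : Continuous fun ξ : ℝ => 𝐞 (-(ξ * -y)) := by fun_prop
    exact h1.smul ((hcont.comp (by fun_prop : Continuous fun ξ : ℝ => (ε, ξ))).mul continuous_tent)
  · filter_upwards [Ioc_mem_nhdsGT (zero_lt_one' ℝ)] with ε hε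
    refine Eventually.of_forall fun ξ => ?_
    rw [Circle.norm_smul]
    exact hC ε hε.2 ξ
  · have h1 : Continuous fun ε : ℝ =>
        𝐞 (-(ξ * -y)) • (H ((max ε 0 : ℝ) + (2 * Real.pi * ξ : ℝ) * I) * tent ξ) :=
      ((hcont.comp (by fun_prop : Continuous fun ε : ℝ => (ε, ξ))).mul_const _).const_smul _
    exact (h1.tendsto 0).mono_left nhdsWithin_le_nhds

lemma tendsto_boundaryIntegral_atTop (H : ℂ → ℂ) (ε : ℝ) :
    Tendsto (boundaryIntegral H ε) atTop (𝓝 0) :=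
  ((Real.tendsto_integral_exp_smul_cocompact fun ξ : ℝ =>
      H ((max ε 0 : ℝ) + (2 * Real.pi * ξ : ℝ) * I) * tent ξ).mono_left
    atBot_le_cocompact).comp tendsto_neg_atTop_atBot

/-- The function `e^{-a x} S(x)`, minus its expected limit `A` on the positive half-line, damped
by `e^{-ε x}`. -/
noncomputable def damped (a A : ℝ) (S : ℝ → ℝ) (ε x : ℝ) : ℝ :=
  Real.exp (-(ε * x)) * (Real.exp (-(a * x)) * S x - (Set.Ioi 0).indicator (fun _ => A) x)

lemma damped_eq (ε : ℝ) : damped a A S ε = fun x => Real.exp (-((a + ε) * x)) * S x -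
    (Set.Ioi 0).indicator (fun x => A * Real.exp (-ε * x)) x := by
  funext x
  rw [damped, mul_sub, ← mul_assoc, ← Real.exp_add]
  congr 1
  · congr 2; ring
  · by_cases hx : x ∈ Set.Ioi (0 : ℝ)
    · simp [hx, mul_comm]
    · simp [hx]

lemma integrable_damped {ε : ℝ} (hε : 0 < ε)
    (hint : Integrable fun x => Real.exp (-((a + ε) * x)) * S x) :
    Integrable (damped a A S ε) := by
  rw [damped_eq]
  refine hint.sub ?_
  rw [integrable_indicator_iff measurableSet_Ioi]
  exact (integrableOn_exp_mul_Ioi (neg_lt_zero.2 hε) 0).const_mul A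

lemma fourier_damped {ε : ℝ} (hε : 0 < ε)
    (hint : Integrable fun x => Real.exp (-((a + ε) * x)) * S x)
    (hL : ∀ s : ℂ, 0 < s.re → ∫ x : ℝ, cexp (-((a + s) * x)) * S x = H s + A / s) (ξ : ℝ) :
    𝓕 (fun x => (damped a A S ε x : ℂ)) ξ
      = H ((max ε 0 : ℝ) + (2 * Real.pi * ξ : ℝ) * I) := by
  set s : ℂ := (max ε 0 : ℝ) + (2 * Real.pi * ξ : ℝ) * I with hs
  have hs' : s = ε + (2 * Real.pi * ξ : ℝ) * I := by rw [hs, max_eq_left hε.le]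
  have hre : s.re = ε := by simp [hs']
  have hs0 : s ≠ 0 := fun h => by rw [h] at hre; simp at hre; exact hε.ne hre
  have hint' : Integrable fun x : ℝ => cexp (-((a + s) * x)) * S x := by
    have hm : AEStronglyMeasurable S volume := by
      have : S = fun x => Real.exp ((a + ε) * x) * (Real.exp (-((a + ε) * x)) * S x) := by
        funext x
        rw [← mul_assoc, ← Real.exp_add]
        simp
      rw [this]
      exact (by fun_prop : Continuous fun x => Real.exp ((a + ε) * x)).aestronglyMeasurable.mul
        hint.aestronglyMeasurable
    refine hint.norm.mono' ((by fun_prop : Continuous fun x : ℝ =>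
      cexp (-((a + s) * x))).aestronglyMeasurable.mul
        (continuous_ofReal.comp_aestronglyMeasurable hm)) (Eventually.of_forall fun x => ?_)
    rw [norm_mul, norm_mul, Complex.norm_exp, Complex.norm_real, Real.norm_of_nonneg (Real.exp_nonneg _)]
    simp [hre]
  have hint2 : IntegrableOn (fun x : ℝ => (A : ℂ) * cexp (-s * x)) (Set.Ioi 0) :=
    (integrableOn_exp_mul_complex_Ioi (by simp [hre, hε]) 0).const_mul _
  have key : ∫ x : ℝ, (cexp (-((a + s) * x)) * S x -
      (Set.Ioi 0).indicator (fun x : ℝ => (A : ℂ) * cexp (-s * x)) x) = H s := by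
    rw [integral_sub hint' ((integrable_indicator_iff measurableSet_Ioi).2 hint2),
      integral_indicator measurableSet_Ioi, hL s (by rw [hre]; exact hε), integral_const_mul,
      integral_exp_mul_complex_Ioi (by simp [hre, hε])]
    simp
    field_simp
    ring
  rw [← key, Real.fourier_eq']
  refine integral_congr_ae (Eventually.of_forall fun x => ?_)
  have hexp (b : ℂ) : cexp (-((b + s) * x)) = cexp (↑(-2 * Real.pi * inner ℝ x ξ) * I) *
      cexp (-((b + ε) * x)) := by
    rw [← Complex.exp_add, hs']
    congr 1
    simp
    ring
  have h0 := hexp 0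
  rw [zero_add, zero_add, ← neg_mul] at h0
  simp only [damped_eq, smul_eq_mul]
  rw [hexp]
  by_cases hx : x ∈ Set.Ioi (0 : ℝ)
  · simp only [hx, Set.indicator_of_mem]
    rw [h0]
    push_cast
    ring_nf
  · simp only [hx, Set.indicator_of_notMem, not_false_eq_true]
    push_cast
    ring_nf

lemma integral_damped_mul_fejer {ε : ℝ} (hε : 0 < ε)
    (hint : Integrable fun x => Real.exp (-((a + ε) * x)) * S x)
    (hL : ∀ s : ℂ, 0 < s.re → ∫ x : ℝ, cexp (-((a + s) * x)) * S x = H s + A / s) (y : ℝ) :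
    ((∫ x, damped a A S ε x * fejer (x - y) : ℝ) : ℂ) = boundaryIntegral H ε y := by
  have h := integral_mul_fejer (f := fun x => (damped a A S ε x : ℂ))
    (integrable_damped hε hint).ofReal y
  simp_rw [fourier_damped hε hint hL] at h
  rw [boundaryIntegral, ← h, ← integral_complex_ofReal]
  simp

lemma integrable_bounded_mul_fejer {g : ℝ → ℝ} (hg : Measurable g) {C : ℝ} (hC : ∀ x, |g x| ≤ C)
    (y : ℝ) : Integrable fun x => g x * fejer (x - y) :=
  (integrable_fejer.comp_sub_right y).bdd_mul hg.aestronglyMeasurable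
    (Eventually.of_forall hC)

lemma exists_bound_of_laplace (hS : Monotone S) (hS0 : ∀ x, 0 ≤ S x) (ha : 0 < a)
    (hH : ContinuousOn H {s | 0 ≤ s.re})
    (hint : ∀ ε > 0, Integrable fun x => Real.exp (-((a + ε) * x)) * S x)
    (hL : ∀ s : ℂ, 0 < s.re → ∫ x : ℝ, cexp (-((a + s) * x)) * S x = H s + A / s) :
    ∃ M, ∀ x, Real.exp (-(a * x)) * S x ≤ M := by
  obtain ⟨C, hC⟩ := exists_bound_boundaryIntegral hH
  set m := ∫ x in (0 : ℝ)..1, fejer x with hm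
  have hmpos : 0 < m := integral_fejer_unit_pos
  refine ⟨(C + |A| * ∫ x, fejer x) / (Real.exp (-a) * m), fun y => ?_⟩
  rw [le_div_iff₀ (by positivity)]
  have hlim : Tendsto (fun ε : ℝ => Real.exp (-(ε * (|y| + 1))) *
      (Real.exp (-(a * y)) * S y * (Real.exp (-a) * m))) (𝓝[>] 0)
      (𝓝 (Real.exp (-(a * y)) * S y * (Real.exp (-a) * m))) := by
    have : Continuous fun ε : ℝ => Real.exp (-(ε * (|y| + 1))) *
      (Real.exp (-(a * y)) * S y * (Real.exp (-a) * m)) := by fun_prop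
    simpa using (this.tendsto 0).mono_left (nhdsWithin_le_nhds (s := Set.Ioi 0))
  refine le_of_tendsto hlim ?_
  filter_upwards [Ioc_mem_nhdsGT (zero_lt_one' ℝ)] with ε hε
  have hfej := integrable_fejer.comp_sub_right y
  have hD : Integrable fun x => damped a A S ε x * fejer (x - y) := by
    obtain ⟨K, hK⟩ : ∃ K, ∀ x, ‖fejer (x - y)‖ ≤ K := by
      refine ⟨∫ v, ‖tent v‖, fun x => ?_⟩
      rw [← Complex.norm_real, ← fourier_tent]
      exact VectorFourier.norm_fourierIntegral_le_integral_norm _ _ _ _ _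
    exact (integrable_damped hε.1 (hint ε hε.1)).mul_bdd
      (continuous_fejer.comp (by fun_prop)).aestronglyMeasurable (Eventually.of_forall hK)
  have hle : ∀ x, Real.exp (-(ε * x)) * (Real.exp (-(a * x)) * S x) ≤ damped a A S ε x + |A| := by
    intro x
    have hexp := Real.exp_pos (-(ε * x))
    rw [damped, mul_sub]
    by_cases hx : x ∈ Set.Ioi (0 : ℝ)
    · have h1 : Real.exp (-(ε * x)) ≤ 1 :=
        Real.exp_le_one_iff.2 (neg_nonpos.2 (mul_nonneg hε.1.le (le_of_lt hx)))
      simp only [hx, Set.indicator_of_mem]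
      nlinarith [le_abs_self A, abs_nonneg A]
    · simp [hx]
  have h0 : ∀ x, 0 ≤ (damped a A S ε x + |A|) * fejer (x - y) := fun x =>
    mul_nonneg (le_trans (mul_nonneg (Real.exp_nonneg _)
      (mul_nonneg (Real.exp_nonneg _) (hS0 x))) (hle x)) (fejer_nonneg _)
  have hI : Integrable fun x => (damped a A S ε x + |A|) * fejer (x - y) := by
    simp_rw [add_mul]
    exact hD.add (hfej.const_mul _)
  have hm' : m = ∫ x in Set.Ioc y (y + 1), fejer (x - y) := by
    rw [← intervalIntegral.integral_of_le (by linarith),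
      intervalIntegral.integral_comp_sub_right]
    simp [hm]
  calc _ = ∫ x in Set.Ioc y (y + 1), (Real.exp (-(ε * (|y| + 1))) *
        (Real.exp (-(a * y)) * S y * Real.exp (-a))) * fejer (x - y) := by
        rw [integral_const_mul, ← hm']; ring
    _ ≤ ∫ x in Set.Ioc y (y + 1), (damped a A S ε x + |A|) * fejer (x - y) := by
        refine setIntegral_mono_on (hfej.const_mul _).integrableOn hI.integrableOn
          measurableSet_Ioc fun x hx => ?_
        refine mul_le_mul_of_nonneg_right (le_trans ?_ (hle x)) (fejer_nonneg _)
        refine mul_le_mul ?_ ?_ (by have := hS0 y; positivity) (Real.exp_nonneg _)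
        · rw [Real.exp_le_exp, neg_le_neg_iff]
          refine mul_le_mul_of_nonneg_left ?_ hε.1.le
          linarith [hx.2, le_abs_self y]
        · rw [mul_right_comm, ← Real.exp_add]
          refine mul_le_mul ?_ (hS hx.1.le) (hS0 y) (Real.exp_nonneg _)
          rw [Real.exp_le_exp]
          nlinarith [hx.2]
    _ ≤ ∫ x, (damped a A S ε x + |A|) * fejer (x - y) :=
        setIntegral_le_integral hI (Eventually.of_forall h0)
    _ = (∫ x, damped a A S ε x * fejer (x - y)) + |A| * ∫ x, fejer x := by
        simp_rw [add_mul]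
        rw [integral_add hD (hfej.const_mul _), integral_const_mul,
          integral_sub_right_eq_self (fun x => fejer x)]
    _ ≤ C + |A| * ∫ x, fejer x := by
        gcongr
        refine le_trans ?_ (hC ε hε.2 y)
        rw [← integral_damped_mul_fejer hε.1 (hint ε hε.1) hL, Complex.norm_real]
        exact le_abs_self _

lemma tendsto_integral_mul_fejer (hS : Monotone S) (hx₀ : x₀ ≤ 0) (hSx₀ : ∀ x < x₀, S x = 0)
    (hS0 : ∀ x, 0 ≤ S x) (ha : 0 < a)
    (hH : ContinuousOn H {s | 0 ≤ s.re})
    (hint : ∀ ε > 0, Integrable fun x => Real.exp (-((a + ε) * x)) * S x)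
    (hL : ∀ s : ℂ, 0 < s.re → ∫ x : ℝ, cexp (-((a + s) * x)) * S x = H s + A / s) :
    Tendsto (fun y => ∫ x, (Real.exp (-(a * x)) * S x) * fejer (x - y)) atTop
      (𝓝 (A * ∫ x, fejer x)) := by
  obtain ⟨M, hM⟩ := exists_bound_of_laplace hS hS0 ha hH hint hL
  have hB0 (x : ℝ) : 0 ≤ Real.exp (-(a * x)) * S x := mul_nonneg (Real.exp_nonneg _) (hS0 x)
  have hBm : Measurable fun x => Real.exp (-(a * x)) * S x :=
    (by fun_prop : Measurable fun x => Real.exp (-(a * x))).mul hS.measurable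
  have hindm : Measurable ((Set.Ioi (0 : ℝ)).indicator fun _ => A) :=
    measurable_const.indicator measurableSet_Ioi
  have hind (x : ℝ) : |(Set.Ioi (0 : ℝ)).indicator (fun _ => A) x| ≤ |A| := by
    by_cases hx : x ∈ Set.Ioi (0 : ℝ) <;> simp [hx]
  have hdm (ε : ℝ) : Measurable (damped a A S ε) :=
    (by fun_prop : Measurable fun x => Real.exp (-(ε * x))).mul (hBm.sub hindm)
  have hzero (y : ℝ) : ((∫ x, damped a A S 0 x * fejer (x - y) : ℝ) : ℂ)
      = boundaryIntegral H 0 y := by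
    refine tendsto_nhds_unique_of_eventuallyEq (l := 𝓝[>] (0 : ℝ)) ?_
      (tendsto_boundaryIntegral_zero hH y) (f := fun ε =>
        ((∫ x, damped a A S ε x * fejer (x - y) : ℝ) : ℂ)) ?_
    · refine (continuous_ofReal.tendsto _).comp ?_
      refine tendsto_integral_filter_of_dominated_convergence
        (fun x => (Real.exp (-x₀) * (M + |A|)) * fejer (x - y)) ?_ ?_
        ((integrable_fejer.comp_sub_right y).const_mul _) (Eventually.of_forall fun x => ?_)
      · exact Eventually.of_forall fun ε => ((hdm ε).mul
          (continuous_fejer.measurable.comp (by fun_prop))).aestronglyMeasurable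
      · filter_upwards [Ioc_mem_nhdsGT (zero_lt_one' ℝ)] with ε hε
        refine Eventually.of_forall fun x => ?_
        rw [norm_mul, Real.norm_of_nonneg (fejer_nonneg _)]
        refine mul_le_mul_of_nonneg_right ?_ (fejer_nonneg _)
        have hMA : 0 ≤ M + |A| := add_nonneg ((hB0 0).trans (hM 0)) (abs_nonneg A)
        rcases lt_or_ge x x₀ with hx | hx
        · have : x ∉ Set.Ioi (0 : ℝ) := by simp; linarith
          rw [damped, hSx₀ x hx, Set.indicator_of_notMem this]
          simp only [mul_zero, sub_zero, norm_zero]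
          positivity
        · rw [damped, norm_mul, Real.norm_of_nonneg (Real.exp_nonneg _)]
          refine mul_le_mul ?_ ?_ (norm_nonneg _) (Real.exp_nonneg _)
          · rw [Real.exp_le_exp]
            nlinarith [hε.1, hε.2]
          · refine (norm_sub_le _ _).trans (add_le_add ?_ (hind x))
            rw [Real.norm_of_nonneg (hB0 x)]
            exact hM x
      · have : Continuous fun ε => damped a A S ε x * fejer (x - y) := by
          unfold damped; fun_prop
        exact (this.tendsto 0).mono_left nhdsWithin_le_nhds
    · filter_upwards [self_mem_nhdsWithin] with ε hε
      exact integral_damped_mul_fejer hε (hint ε hε) hL y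
  have h1 : Tendsto (fun y => ∫ x, damped a A S 0 x * fejer (x - y)) atTop (𝓝 0) := by
    have := (tendsto_boundaryIntegral_atTop H 0).congr fun y => (hzero y).symm
    simpa [Function.comp_def] using (continuous_re.tendsto 0).comp this
  have h2 : Tendsto (fun y => ∫ x, (Set.Ioi (0 : ℝ)).indicator (fun _ => A) x * fejer (x - y))
      atTop (𝓝 (A * ∫ x, fejer x)) := by
    have heq (y : ℝ) : ∫ x, (Set.Ioi (0 : ℝ)).indicator (fun _ => A) x * fejer (x - y)
        = ∫ x, (Set.Ioi (0 : ℝ)).indicator (fun _ => A) (x + y) * fejer x := by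
      rw [← integral_add_right_eq_self _ y]
      simp
    simp_rw [heq]
    rw [← integral_const_mul]
    refine tendsto_integral_filter_of_dominated_convergence (fun x => |A| * fejer x) ?_ ?_
      (integrable_fejer.const_mul _) (Eventually.of_forall fun x => ?_)
    · exact Eventually.of_forall fun y => ((hindm.comp (by fun_prop)).mul
        continuous_fejer.measurable).aestronglyMeasurable
    · refine Eventually.of_forall fun y => Eventually.of_forall fun x => ?_
      rw [norm_mul, Real.norm_of_nonneg (fejer_nonneg _)]
      exact mul_le_mul_of_nonneg_right (hind _) (fejer_nonneg _)
    · refine tendsto_const_nhds.congr' ?_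
      filter_upwards [eventually_gt_atTop (-x)] with y hy
      rw [Set.indicator_of_mem (by simp; linarith)]
  have h3 := h1.add h2
  rw [zero_add] at h3
  refine h3.congr fun y => ?_
  rw [← integral_add]
  · simp [damped, sub_mul]
  · refine integrable_bounded_mul_fejer (hdm 0) (C := M + |A|) (fun x => ?_) y
    simp only [damped, zero_mul, neg_zero, Real.exp_zero, one_mul]
    refine (abs_sub _ _).trans (add_le_add ?_ (hind x))
    rw [abs_of_nonneg (hB0 x)]
    exact hM x
  · exact integrable_bounded_mul_fejer hindm hind y

lemma tendsto_integral_comp_div_mul_fejer (hS : Monotone S) (hx₀ : x₀ ≤ 0)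
    (hSx₀ : ∀ x < x₀, S x = 0) (hS0 : ∀ x, 0 ≤ S x) (ha : 0 < a)
    (hH : ContinuousOn H {s | 0 ≤ s.re})
    (hint : ∀ ε > 0, Integrable fun x => Real.exp (-((a + ε) * x)) * S x)
    (hL : ∀ s : ℂ, 0 < s.re → ∫ x : ℝ, cexp (-((a + s) * x)) * S x = H s + A / s)
    {T : ℝ} (hT : 0 < T) :
    Tendsto (fun y => ∫ x, (Real.exp (-(a * (x / T))) * S (x / T)) * fejer (x - y)) atTop
      (𝓝 (A * ∫ x, fejer x)) := by
  have hTC : (T : ℂ) ≠ 0 := by exact_mod_cast hT.ne'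
  have h := tendsto_integral_mul_fejer (S := fun x => S (x / T)) (x₀ := T * x₀) (a := a / T)
    (A := A) (H := fun s => T * H (T * s))
    (fun x y hxy => hS (by gcongr)) (mul_nonpos_of_nonneg_of_nonpos hT.le hx₀)
    (fun x hx => hSx₀ _ (by rwa [div_lt_iff₀' hT])) (fun x => hS0 _) (by positivity)
    (continuousOn_const.mul (hH.comp (by fun_prop) fun s hs => by
      simpa using mul_nonneg hT.le hs))
    (fun ε hε => by
      refine ((hint (T * ε) (by positivity)).comp_div hT.ne').congr
        (Eventually.of_forall fun x => ?_)
      simp only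
      congr 2
      field_simp)
    (fun s hs => by
      have h1 := hL (T * s) (by simpa using mul_pos hT hs)
      have h2 := Measure.integral_comp_div
        (fun x : ℝ => cexp (-((a + T * s) * x)) * (S x : ℂ)) T
      rw [h1, abs_of_pos hT, real_smul] at h2
      have h3 : (T : ℂ) * (H (T * s) + A / (T * s)) = T * H (T * s) + A / s := by
        have : s ≠ 0 := fun h => by simp [h] at hs
        field_simp
      rw [← h3, ← h2]
      refine integral_congr_ae (Eventually.of_forall fun x => ?_)
      simp only
      congr 2
      push_cast
      field_simp)
  refine h.congr fun y => integral_congr_ae (Eventually.of_forall fun x => ?_)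
  simp only
  congr 3
  ring

lemma setIntegral_fejer_sub (R y : ℝ) :
    ∫ x in Set.Ioc (y - R) (y + R), fejer (x - y) = ∫ x in Set.Ioc (-R) R, fejer x := by
  rcases le_or_gt 0 R with hR | hR
  · rw [← intervalIntegral.integral_of_le (by linarith),
      ← intervalIntegral.integral_of_le (by linarith), intervalIntegral.integral_comp_sub_right]
    simp
  · simp [Set.Ioc_eq_empty_of_le (show y + R ≤ y - R by linarith),
      Set.Ioc_eq_empty_of_le (show R ≤ -R by linarith)]

lemma tendsto_setIntegral_fejer :
    Tendsto (fun R : ℝ => ∫ x in Set.Ioc (-R) R, fejer x) atTop (𝓝 (∫ x, fejer x)) := by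
  refine (intervalIntegral_tendsto_integral integrable_fejer tendsto_neg_atTop_atBot
    tendsto_id).congr' ?_
  filter_upwards [eventually_ge_atTop 0] with R hR
  rw [id, intervalIntegral.integral_of_le (by linarith)]

/-- Slow decrease gives an upper bound by the smoothed average. -/
lemma mul_le_integral_comp_div_mul_fejer (hS : Monotone S) (hS0 : ∀ x, 0 ≤ S x) (ha : 0 < a)
    {M : ℝ} (hM : ∀ x, Real.exp (-(a * x)) * S x ≤ M) {R : ℝ} (hR : 0 < R) (y : ℝ) :
    Real.exp (-(a * y)) * S y * (Real.exp (-(2 * a / R)) * ∫ x in Set.Ioc (-R) R, fejer x)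
      ≤ ∫ x, (Real.exp (-(a * (x / R ^ 2))) * S (x / R ^ 2)) * fejer (x - (R ^ 2 * y + R)) := by
  have hB0 (x : ℝ) : 0 ≤ Real.exp (-(a * x)) * S x := mul_nonneg (Real.exp_nonneg _) (hS0 x)
  have hBm : Measurable fun x => Real.exp (-(a * (x / R ^ 2))) * S (x / R ^ 2) :=
    (by fun_prop : Measurable fun x => Real.exp (-(a * (x / R ^ 2)))).mul
      (hS.measurable.comp (by fun_prop))
  have hI := integrable_bounded_mul_fejer hBm (C := M)
    (fun x => by rw [abs_of_nonneg (hB0 _)]; exact hM _) (R ^ 2 * y + R)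
  set z := R ^ 2 * y + R with hz
  rw [← setIntegral_fejer_sub R z, ← mul_assoc, ← integral_const_mul]
  refine le_trans (setIntegral_mono_on
    ((integrable_fejer.comp_sub_right z).const_mul _).integrableOn hI.integrableOn
    measurableSet_Ioc fun x hx => ?_) (setIntegral_le_integral hI
      (Eventually.of_forall fun x => mul_nonneg (hB0 _) (fejer_nonneg _)))
  refine mul_le_mul_of_nonneg_right ?_ (fejer_nonneg _)
  have h1 : y ≤ x / R ^ 2 := by
    rw [le_div_iff₀ (by positivity)]; linarith [hx.1]
  have h2 : x / R ^ 2 ≤ y + 2 / R := by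
    rw [div_le_iff₀ (by positivity)]
    have : (y + 2 / R) * R ^ 2 = R ^ 2 * y + 2 * R := by field_simp
    linarith [hx.2]
  rw [mul_right_comm, ← Real.exp_add]
  refine mul_le_mul ?_ (hS h1) (hS0 y) (Real.exp_nonneg _)
  rw [Real.exp_le_exp]
  have : a * (x / R ^ 2) ≤ a * (y + 2 / R) := by gcongr
  have h3 : a * (y + 2 / R) = a * y + 2 * a / R := by ring
  linarith

/-- Slow decrease gives a lower bound by the smoothed average. -/
lemma integral_comp_div_mul_fejer_le (hS : Monotone S) (hS0 : ∀ x, 0 ≤ S x) (ha : 0 < a)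
    {M : ℝ} (hM : ∀ x, Real.exp (-(a * x)) * S x ≤ M) {R : ℝ} (hR : 0 < R) (y : ℝ) :
    ∫ x, (Real.exp (-(a * (x / R ^ 2))) * S (x / R ^ 2)) * fejer (x - (R ^ 2 * y - R))
      ≤ Real.exp (-(a * y)) * S y * (Real.exp (2 * a / R) * ∫ x, fejer x)
        + M * ((∫ x, fejer x) - ∫ x in Set.Ioc (-R) R, fejer x) := by
  have hB0 (x : ℝ) : 0 ≤ Real.exp (-(a * x)) * S x := mul_nonneg (Real.exp_nonneg _) (hS0 x)
  have hBm : Measurable fun x => Real.exp (-(a * (x / R ^ 2))) * S (x / R ^ 2) :=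
    (by fun_prop : Measurable fun x => Real.exp (-(a * (x / R ^ 2)))).mul
      (hS.measurable.comp (by fun_prop))
  have hI := integrable_bounded_mul_fejer hBm (C := M)
    (fun x => by rw [abs_of_nonneg (hB0 _)]; exact hM _) (R ^ 2 * y - R)
  set z := R ^ 2 * y - R with hz
  have hf := integrable_fejer.comp_sub_right z
  rw [← integral_add_compl (measurableSet_Ioc (a := z - R) (b := z + R)) hI]
  have hcompl : (∫ x, fejer x) - ∫ x in Set.Ioc (-R) R, fejer x
      = ∫ x in (Set.Ioc (z - R) (z + R))ᶜ, fejer (x - z) := by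
    rw [← setIntegral_fejer_sub R z, ← integral_sub_right_eq_self (fun x => fejer x) z,
      ← integral_add_compl (measurableSet_Ioc (a := z - R) (b := z + R)) hf]
    ring
  rw [hcompl, ← integral_const_mul M]
  refine add_le_add ?_ (setIntegral_mono_on hI.integrableOn (hf.const_mul _).integrableOn
    measurableSet_Ioc.compl fun x _ => mul_le_mul_of_nonneg_right (hM _) (fejer_nonneg _))
  rw [← integral_sub_right_eq_self (fun x => fejer x) z, ← mul_assoc, ← integral_const_mul]
  refine le_trans (setIntegral_mono_on hI.integrableOn (hf.const_mul
    (Real.exp (-(a * y)) * S y * Real.exp (2 * a / R))).integrableOn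
    measurableSet_Ioc fun x hx => ?_) (setIntegral_le_integral (hf.const_mul _)
      (Eventually.of_forall fun x => mul_nonneg (mul_nonneg (hB0 _) (Real.exp_nonneg _))
        (fejer_nonneg _)))
  refine mul_le_mul_of_nonneg_right ?_ (fejer_nonneg _)
  have h1 : x / R ^ 2 ≤ y := by
    rw [div_le_iff₀ (by positivity)]; linarith [hx.2]
  have h2 : y - 2 / R ≤ x / R ^ 2 := by
    rw [le_div_iff₀ (by positivity)]
    have : (y - 2 / R) * R ^ 2 = R ^ 2 * y - 2 * R := by field_simp
    linarith [hx.1]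
  rw [mul_right_comm, ← Real.exp_add]
  refine mul_le_mul ?_ (hS h1) (hS0 _) (Real.exp_nonneg _)
  rw [Real.exp_le_exp]
  have : a * (y - 2 / R) ≤ a * (x / R ^ 2) := by gcongr
  have h3 : a * (y - 2 / R) = a * y - 2 * a / R := by ring
  linarith

/-- The **Wiener–Ikehara theorem** for Laplace transforms of monotone functions. -/
theorem tendsto_exp_mul_of_laplace (hS : Monotone S) (hx₀ : x₀ ≤ 0)
    (hSx₀ : ∀ x < x₀, S x = 0) (hS0 : ∀ x, 0 ≤ S x) (ha : 0 < a)
    (hH : ContinuousOn H {s | 0 ≤ s.re})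
    (hint : ∀ ε > 0, Integrable fun x => Real.exp (-((a + ε) * x)) * S x)
    (hL : ∀ s : ℂ, 0 < s.re → ∫ x : ℝ, cexp (-((a + s) * x)) * S x = H s + A / s) :
    Tendsto (fun x => Real.exp (-(a * x)) * S x) atTop (𝓝 A) := by
  obtain ⟨M, hM⟩ := exists_bound_of_laplace hS hS0 ha hH hint hL
  set c := ∫ x, fejer x with hc
  have hc0 : 0 < c := integral_fejer_pos
  set m : ℝ → ℝ := fun R => ∫ x in Set.Ioc (-R) R, fejer x with hm
  have hmlim : Tendsto m atTop (𝓝 c) := tendsto_setIntegral_fejer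
  have hinv : Tendsto (fun R : ℝ => 1 / R) atTop (𝓝 0) :=
    tendsto_const_nhds.div_atTop tendsto_id
  have hdiv : Tendsto (fun R : ℝ => 2 * a / R) atTop (𝓝 0) :=
    tendsto_const_nhds.div_atTop tendsto_id
  have hexp1 : Tendsto (fun R : ℝ => Real.exp (-(2 * a / R))) atTop (𝓝 1) := by
    simpa [Function.comp_def] using (Real.continuous_exp.tendsto _).comp hdiv.neg
  have hexp2 : Tendsto (fun R : ℝ => Real.exp (2 * a / R)) atTop (𝓝 1) := by
    simpa [Function.comp_def] using (Real.continuous_exp.tendsto _).comp hdiv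
  have hsm (R : ℝ) (hR : 0 < R) := tendsto_integral_comp_div_mul_fejer hS hx₀ hSx₀ hS0 ha hH hint
    hL (pow_pos hR 2)
  refine tendsto_order.2 ⟨fun b hb => ?_, fun b hb => ?_⟩
  · have hlow : Tendsto (fun R : ℝ => b * (Real.exp (2 * a / R) * c) + M * (c - m R) + 1 / R)
        atTop (𝓝 (b * (1 * c) + M * (c - c) + 0)) :=
      (((hexp2.mul_const c).const_mul b).add ((hmlim.const_sub c).const_mul M)).add hinv
    have hlt : b * (1 * c) + M * (c - c) + 0 < A * c := by nlinarith
    obtain ⟨R, hR, hR0⟩ := ((hlow.eventually_lt_const hlt).and (eventually_gt_atTop 0)).exists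
    have hto : Tendsto (fun y : ℝ => R ^ 2 * y - R) atTop atTop :=
      tendsto_atTop_add_const_right _ _ (tendsto_id.const_mul_atTop (pow_pos hR0 2))
    filter_upwards [((hsm R hR0).comp hto).eventually_const_lt hR] with y hy
    have h1 := integral_comp_div_mul_fejer_le hS hS0 ha hM hR0 y
    have h2 : 0 < 1 / R := by positivity
    have h3 : b * (Real.exp (2 * a / R) * c)
        < Real.exp (-(a * y)) * S y * (Real.exp (2 * a / R) * c) := by
      simp only [Function.comp_apply] at hy
      linarith
    exact lt_of_mul_lt_mul_right h3 (by positivity)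
  · have hup : Tendsto (fun R : ℝ => b * (Real.exp (-(2 * a / R)) * m R))
        atTop (𝓝 (b * (1 * c))) := (hexp1.mul hmlim).const_mul b
    have hlt : A * c < b * (1 * c) := by nlinarith
    obtain ⟨R, ⟨hR, hR0⟩, hRm⟩ := (((hup.eventually_const_lt hlt).and
      (eventually_gt_atTop 0)).and (hmlim.eventually_const_lt hc0)).exists
    have hto : Tendsto (fun y : ℝ => R ^ 2 * y + R) atTop atTop :=
      tendsto_atTop_add_const_right _ _ (tendsto_id.const_mul_atTop (pow_pos hR0 2))
    filter_upwards [((hsm R hR0).comp hto).eventually_lt_const hR] with y hy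
    have h1 := mul_le_integral_comp_div_mul_fejer hS hS0 ha hM hR0 y
    exact lt_of_mul_lt_mul_right (h1.trans_lt hy) (by positivity)

end Tauberian

section CountingFunction

variable {c lam : ℕ → ℝ}

lemma summable_counting (hinf : Tendsto lam atTop atTop) (L : ℝ) :
    Summable fun j => if lam j ≤ L then c j else 0 := by
  obtain ⟨N, hN⟩ := eventually_atTop.1 (hinf.eventually_gt_atTop L)
  refine summable_of_ne_finset_zero (s := Finset.range N) fun j hj => ?_
  rw [if_neg (not_le.2 (hN j (by simpa using hj)))]

/-- The contribution of one jump to the Laplace transform of the counting function. -/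
lemma jump_eq_indicator {l : ℝ} (hl : 0 < l) (k b : ℂ) (x : ℝ) :
    cexp (-(b * x)) * (if l ≤ Real.exp x then k else 0)
      = (Set.Ici (Real.log l)).indicator (fun x : ℝ => k * cexp (-b * x)) x := by
  by_cases h : l ≤ Real.exp x
  · rw [if_pos h, Set.indicator_of_mem (Set.mem_Ici.2 ((Real.log_le_iff_le_exp hl).2 h))]
    ring_nf
  · rw [if_neg h, mul_zero, Set.indicator_of_notMem fun h' =>
      h ((Real.log_le_iff_le_exp hl).1 (Set.mem_Ici.1 h'))]

lemma integrable_jump {l : ℝ} (hl : 0 < l) (k : ℂ) {b : ℂ} (hb : 0 < b.re) :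
    Integrable fun x : ℝ => cexp (-(b * x)) * (if l ≤ Real.exp x then k else 0) := by
  simp_rw [jump_eq_indicator hl]
  rw [integrable_indicator_iff measurableSet_Ici, integrableOn_Ici_iff_integrableOn_Ioi]
  exact (integrableOn_exp_mul_complex_Ioi (by simpa using hb) _).const_mul k

lemma integral_jump {l : ℝ} (hl : 0 < l) (k : ℂ) {b : ℂ} (hb : 0 < b.re) :
    ∫ x : ℝ, cexp (-(b * x)) * (if l ≤ Real.exp x then k else 0) = k * (l : ℂ) ^ (-b) / b := by
  simp_rw [jump_eq_indicator hl]
  rw [integral_indicator measurableSet_Ici, integral_Ici_eq_integral_Ioi, integral_const_mul,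
    integral_exp_mul_complex_Ioi (by simpa using hb),
    cpow_def_of_ne_zero (by exact_mod_cast hl.ne'), ← ofReal_log hl.le, neg_div_neg_eq,
    mul_comm (-b), mul_div_assoc]

lemma integral_norm_jump {l k : ℝ} (hl : 0 < l) (hk : 0 ≤ k) {b : ℂ} (hb : 0 < b.re) :
    ∫ x : ℝ, ‖cexp (-(b * x)) * (if l ≤ Real.exp x then (k : ℂ) else 0)‖
      = ‖(k : ℂ) * (l : ℂ) ^ (-b)‖ / b.re := by
  have h := integral_jump hl (k : ℂ) (b := (b.re : ℂ)) (by simpa using hb)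
  have h1 (x : ℝ) : cexp (-((b.re : ℂ) * x)) * (if l ≤ Real.exp x then (k : ℂ) else 0)
      = (‖cexp (-(b * x)) * (if l ≤ Real.exp x then (k : ℂ) else 0)‖ : ℝ) := by
    rw [norm_mul, Complex.norm_exp]
    split_ifs <;> simp [abs_of_nonneg hk]
  simp_rw [h1] at h
  rw [integral_complex_ofReal] at h
  have h2 : (k : ℂ) * (l : ℂ) ^ (-(b.re : ℂ)) = (‖(k : ℂ) * (l : ℂ) ^ (-b)‖ : ℝ) := by
    rw [norm_mul, norm_cpow_eq_rpow_re_of_pos hl, ← ofReal_neg, ← ofReal_cpow hl.le]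
    simp [abs_of_nonneg hk]
  rw [h2, ← ofReal_div] at h
  exact_mod_cast h

lemma hasSum_laplace_counting (hc : ∀ j, 0 ≤ c j) (hpos : ∀ j, 0 < lam j)
    {b : ℂ} (hb : 0 < b.re) (hsum : Summable fun j => (c j : ℂ) * (lam j : ℂ) ^ (-b)) :
    HasSum (fun j => (c j : ℂ) * (lam j : ℂ) ^ (-b) / b)
      (∫ x : ℝ, cexp (-(b * x)) * (∑' j, if lam j ≤ Real.exp x then c j else 0 : ℝ)) := by
  have h := hasSum_integral_of_summable_integral_norm
    (F := fun j (x : ℝ) => cexp (-(b * x)) * (if lam j ≤ Real.exp x then (c j : ℂ) else 0))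
    (μ := volume) (fun j => integrable_jump (hpos j) _ hb) (by
      simp_rw [fun j => integral_norm_jump (hpos j) (hc j) hb]
      exact hsum.norm.div_const _)
  simp_rw [fun j => integral_jump (hpos j) (c j : ℂ) hb, tsum_mul_left] at h
  have hcast (x : ℝ) : ((∑' j, if lam j ≤ Real.exp x then c j else 0 : ℝ) : ℂ)
      = ∑' j, if lam j ≤ Real.exp x then (c j : ℂ) else 0 := by
    rw [ofReal_tsum]
    refine tsum_congr fun j => ?_
    split_ifs <;> simp
  simp_rw [hcast]
  exact h

lemma integrable_exp_mul_counting (hc : ∀ j, 0 ≤ c j) (hpos : ∀ j, 0 < lam j)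
    {b : ℝ} (hb : 0 < b) (hsum : Summable fun j => (c j : ℂ) * (lam j : ℂ) ^ (-(b : ℂ))) :
    Integrable fun x : ℝ =>
      Real.exp (-(b * x)) * (∑' j, if lam j ≤ Real.exp x then c j else 0) := by
  have h := hasSum_laplace_counting hc hpos (b := (b : ℂ)) (by simpa using hb) hsum
  have hterm (j : ℕ) : (c j : ℂ) * (lam j : ℂ) ^ (-(b : ℂ)) / b
      = (c j * lam j ^ (-b) / b : ℝ) := by
    rw [ofReal_div, ofReal_mul, ofReal_cpow (hpos j).le, ofReal_neg]
  have hfun (x : ℝ) : cexp (-((b : ℂ) * x)) * (∑' j, if lam j ≤ Real.exp x then c j else 0 : ℝ)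
      = (Real.exp (-(b * x)) * (∑' j, if lam j ≤ Real.exp x then c j else 0) : ℝ) := by
    push_cast
    rfl
  simp_rw [hterm, hfun] at h
  rw [integral_complex_ofReal, hasSum_ofReal] at h
  by_contra hni
  rw [integral_undef hni, hasSum_zero_iff_of_nonneg fun j => by
    have := hc j; have := hpos j; positivity] at h
  refine hni ?_
  have hc0 (j : ℕ) : c j = 0 := by
    have hj := congrFun h j
    have h1 := Real.rpow_pos_of_pos (hpos j) (-b)
    simpa [hb.ne', h1.ne'] using hj
  simp [hc0]

end CountingFunction

/-- The Tauberian (Ikehara-type) step in the local Weyl law: if the generalized zeta function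
`ζ_A(z) = ∑_j c_j λ_j^z` (with `c_j = ⟨Aψ_j, ψ_j⟩ ≥ 0` and eigenvalues `0 < λ_1 ≤ λ_2 ≤ ⋯ → ∞`),
convergent for `Re z < -n`, extends meromorphically to `Re z < -n + 1` with a single simple pole
at `z = -n` with residue `r > 0` (i.e. `ζ_A(z) = G(z) + r/(-n - z)` with `G` analytic on the
half-plane), then `N_A(λ) = ∑_{λ_j ≤ λ} c_j ∼ (r/n) λ^n` as `λ → +∞`. -/
theorem local_weyl_tauberian (n : ℕ) (hn : 0 < n)
    (c : ℕ → ℝ) (hc : ∀ j, 0 ≤ c j)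
    (lam : ℕ → ℝ) (hpos : ∀ j, 0 < lam j) (hmono : Monotone lam)
    (hinf : Tendsto lam atTop atTop)
    (hsum : ∀ z : ℂ, z.re < -(n : ℝ) → Summable fun j => (c j : ℂ) * (lam j : ℂ) ^ z)
    (r : ℝ) (hr : 0 < r) (G : ℂ → ℂ)
    (hG : AnalyticOnNhd ℂ G {z : ℂ | z.re < -(n : ℝ) + 1})
    (hpole : ∀ z : ℂ, z.re < -(n : ℝ) →
      (∑' j, (c j : ℂ) * (lam j : ℂ) ^ z) = G z + (r : ℂ) / (-(n : ℂ) - z)) :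
    Tendsto (fun L : ℝ => (∑' j, if lam j ≤ L then c j else 0) / L ^ n)
      atTop (nhds (r / n)) := by
  set S : ℝ → ℝ := fun x => ∑' j, if lam j ≤ Real.exp x then c j else 0 with hSdef
  have hn' : (0 : ℝ) < n := by exact_mod_cast hn
  have hterm (L : ℝ) (j : ℕ) : 0 ≤ if lam j ≤ L then c j else 0 := by
    split_ifs
    exacts [hc j, le_rfl]
  have hS0 (x : ℝ) : 0 ≤ S x := tsum_nonneg (hterm _)
  have hS : Monotone S := fun x y hxy => by
    refine (summable_counting hinf _).tsum_le_tsum (fun j => ?_) (summable_counting hinf _)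
    by_cases h : lam j ≤ Real.exp x
    · rw [if_pos h, if_pos (h.trans (Real.exp_le_exp.2 hxy))]
    · rw [if_neg h]
      exact hterm _ j
  have hSx₀ : ∀ x < min 0 (Real.log (lam 0)), S x = 0 := fun x hx => by
    have h1 : Real.exp x < lam 0 :=
      (Real.lt_log_iff_exp_lt (hpos 0)).1 (hx.trans_le (min_le_right _ _))
    have h2 (j : ℕ) : ¬ lam j ≤ Real.exp x := not_le.2 (h1.trans_le (hmono (Nat.zero_le j)))
    simp [hSdef, h2]
  have hre {s : ℂ} (hs : 0 < s.re) : (-((n : ℝ) + s : ℂ)).re < -(n : ℝ) := by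
    simpa using hs
  have hint : ∀ ε > 0, Integrable fun x => Real.exp (-(((n : ℝ) + ε) * x)) * S x :=
    fun ε hε => integrable_exp_mul_counting hc hpos (by positivity)
      (hsum _ (by simpa using hε))
  set H : ℂ → ℂ := fun s => (G (-((n : ℝ) + s)) - (r / n : ℝ)) / ((n : ℝ) + s) with hHdef
  have hH : ContinuousOn H {s | 0 ≤ s.re} := by
    refine ContinuousOn.div (ContinuousOn.sub (hG.continuousOn.comp (by fun_prop) fun s hs => ?_)
      continuousOn_const) (by fun_prop) fun s hs h0 => ?_
    · simp only [Set.mem_ofPred_eq] at hs ⊢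
      simp
      linarith
    · have := congrArg re h0
      simp only [Set.mem_ofPred_eq] at hs
      simp at this
      linarith
  have hL : ∀ s : ℂ, 0 < s.re →
      ∫ x : ℝ, cexp (-(((n : ℝ) + s) * x)) * S x = H s + (r / n : ℝ) / s := fun s hs => by
    have hb : 0 < ((n : ℝ) + s : ℂ).re := by simp; linarith
    have h := hasSum_laplace_counting hc hpos hb (hsum _ (hre hs))
    rw [← h.tsum_eq, tsum_div_const, hpole _ (hre hs), hHdef]
    have h1 : ((n : ℝ) + s : ℂ) ≠ 0 := fun h0 => by rw [h0] at hb; simp at hb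
    have h2 : s ≠ 0 := fun h0 => by simp [h0] at hs
    have h3 : (n : ℂ) ≠ 0 := by exact_mod_cast hn.ne'
    push_cast at h1 ⊢
    have h4 : -(n : ℂ) - -((n : ℂ) + s) = s := by ring
    rw [h4]
    field_simp
    ring
  have key := (tendsto_exp_mul_of_laplace hS (min_le_left _ _) hSx₀ hS0 hn' hH hint hL).comp
    Real.tendsto_log_atTop
  refine key.congr' ?_
  filter_upwards [eventually_gt_atTop 0] with L hL0
  simp only [Function.comp_apply, hSdef, Real.exp_log hL0]
  rw [Real.exp_neg, Real.exp_nat_mul, Real.exp_log hL0]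
  ring
end
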